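/- arXiv:2404.04380 — 2 statements merged into one kernel-verified Lean document; each statement's English description precedes it below -/
import Mathlib

section
/- Let G be a finite connected simple graph with at least one edge and let n ≥ 2. The ideal I(G)^n is Lyubeznik — i.e., there exists a total order on mingens(I(G)^n) such that no Lyubeznik-critical subset has a bridge — if and only if either G is a single edge (K_2), or n = 2 and G is a path of length 2 (the path P_3 on 3 vertices). -/
open scoped Classical

noncomputable section

namespace ChauHaMaithani

variable {V : Type*}

/-- The lcm of a finite set of monomials (exponent vectors): pointwise maximum. -/
def mlcm (σ : Finset (V → ℕ)) : V → ℕ := fun v => σ.sup fun g => g v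

/-- `m` is a bridge of `σ`: `m ∈ σ` and dropping `m` does not change the lcm. -/
def IsBridge (σ : Finset (V → ℕ)) (m : V → ℕ) : Prop :=
  m ∈ σ ∧ mlcm (σ.erase m) = mlcm σ

/-- `m` is a gap of `σ`: `m ∉ σ` and adding `m` does not change the lcm. -/
def IsGap (σ : Finset (V → ℕ)) (m : V → ℕ) : Prop :=
  m ∉ σ ∧ mlcm (insert m σ) = mlcm σ

/-- A total order `≻` on monomials is encoded by a ranking function `ord`:
`m ≻ m'` iff `ord m' < ord m` (injectivity on the generating set is assumed separately).
`m` is a true gap of `σ` if it is a gap and every bridge of `σ ∪ {m}` dominated by `m`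
is already a bridge of `σ`. -/
def IsTrueGap (ord : (V → ℕ) → ℕ) (σ : Finset (V → ℕ)) (m : V → ℕ) : Prop :=
  IsGap σ m ∧ ∀ m', IsBridge (insert m σ) m' → ord m' < ord m → IsBridge σ m'

/-- `σ` is type-1: it has a true gap (in `M`) dominating none of its bridges. -/
def Type1 (M : Finset (V → ℕ)) (ord : (V → ℕ) → ℕ) (σ : Finset (V → ℕ)) : Prop :=
  ∃ m ∈ M, IsTrueGap ord σ m ∧ ∀ b, IsBridge σ b → ¬ ord b < ord m

/-- `σ` is potentially-type-2: it has a bridge dominating none of its true gaps. -/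
def PotType2 (M : Finset (V → ℕ)) (ord : (V → ℕ) → ℕ) (σ : Finset (V → ℕ)) : Prop :=
  ∃ b, IsBridge σ b ∧ ∀ m ∈ M, IsTrueGap ord σ m → ¬ ord m < ord b

/-- `b` is the `≻`-smallest bridge of `σ`. -/
def IsSBridge (ord : (V → ℕ) → ℕ) (σ : Finset (V → ℕ)) (b : V → ℕ) : Prop :=
  IsBridge σ b ∧ ∀ b', IsBridge σ b' → ord b ≤ ord b'

/-- `σ` is type-2. -/
def Type2 (M : Finset (V → ℕ)) (ord : (V → ℕ) → ℕ) (σ : Finset (V → ℕ)) : Prop :=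
  PotType2 M ord σ ∧
    ∀ σ' : Finset (V → ℕ), σ' ⊆ M → σ' ≠ σ → PotType2 M ord σ' →
      ∀ b b', IsSBridge ord σ b → IsSBridge ord σ' b' →
        σ'.erase b' = σ.erase b → ord b < ord b'

/-- `M` (the minimal generating set of a monomial ideal) is bridge-friendly w.r.t. `ord`:
every potentially-type-2 subset is type-2. -/
def BridgeFriendlyWrt (M : Finset (V → ℕ)) (ord : (V → ℕ) → ℕ) : Prop :=
  ∀ σ ⊆ M, PotType2 M ord σ → Type2 M ord σ

/-- `M` is bridge-friendly: bridge-friendly w.r.t. some total order on `M`. -/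
def BridgeFriendly (M : Finset (V → ℕ)) : Prop :=
  ∃ ord : (V → ℕ) → ℕ, Set.InjOn ord M ∧ BridgeFriendlyWrt M ord

/-- `σ = {m_1 ≻ ⋯ ≻ m_k} ⊆ M` is Lyubeznik-critical w.r.t. `ord`: there is no `m ∈ M` with
`m_t ≻ m` and `m ∣ lcm(m_1, …, m_t)` for some `1 < t ≤ k`. -/
def LyubCritical (M : Finset (V → ℕ)) (ord : (V → ℕ) → ℕ) (σ : Finset (V → ℕ)) : Prop :=
  σ ⊆ M ∧ ¬ ∃ m ∈ M, ∃ t ∈ σ, (∃ u ∈ σ, ord t < ord u) ∧ ord m < ord t ∧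
      ∀ v, m v ≤ mlcm (σ.filter fun g => ord t ≤ ord g) v

/-- `M` is Lyubeznik: for some total order on `M`, no Lyubeznik-critical subset has a
bridge (equivalently, the associated Lyubeznik resolution is minimal). -/
def IsLyubeznik (M : Finset (V → ℕ)) : Prop :=
  ∃ ord : (V → ℕ) → ℕ, Set.InjOn ord M ∧
    ∀ σ : Finset (V → ℕ), LyubCritical M ord σ → ∀ b, ¬ IsBridge σ b

/-- The quadratic monomial `xy` attached to an edge `e = {x,y}`. -/
def edgeMon (e : Sym2 V) : V → ℕ := fun v => if v ∈ e then 1 else 0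

/-- `mingens(I(G))`: the edge monomials of `G`. -/
def edgeGens [Fintype V] (G : SimpleGraph V) : Finset (V → ℕ) :=
  (Finset.univ.filter fun e : Sym2 V => e ∈ G.edgeSet).image edgeMon

/-- `mingens(I(G)^n)`: the monomials that are products of `n` edges of `G`. -/
def edgePowGens [Fintype V] (G : SimpleGraph V) (n : ℕ) : Finset (V → ℕ) :=
  (Finset.univ.filter fun f : Fin n → Sym2 V => ∀ i, f i ∈ G.edgeSet).image
    fun f => ∑ i, edgeMon (f i)

/-- A graph is chordal if it contains no induced cycle of length at least 4. -/
def Chordal (G : SimpleGraph V) : Prop :=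
  ∀ n, 4 ≤ n → IsEmpty (SimpleGraph.cycleGraph n ↪g G)


/-- Vertex type of the graph `L(a,b,c)`: `Sum.inl 0` is `x`, `Sum.inl 1` is `y`,
and the remaining summands are the leaves `x_i`, the leaves `y_j`, and the
triangle tips `z_k`. -/
abbrev LV (a b c : ℕ) := Fin 2 ⊕ (Fin a ⊕ Fin b ⊕ Fin c)

/-- The graph `L(a,b,c)`: `c` triangles glued along the common edge `{x,y}`, with
`a` leaves attached to `x` and `b` leaves attached to `y`. -/
def LGraph (a b c : ℕ) : SimpleGraph (LV a b c) :=
  SimpleGraph.fromRel fun u v =>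
    (u = Sum.inl 0 ∧ v = Sum.inl 1) ∨
    (∃ i, u = Sum.inl 0 ∧ v = Sum.inr (Sum.inl i)) ∨
    (∃ j, u = Sum.inl 1 ∧ v = Sum.inr (Sum.inr (Sum.inl j))) ∨
    (∃ k, (u = Sum.inl 0 ∨ u = Sum.inl 1) ∧ v = Sum.inr (Sum.inr (Sum.inr k)))

/-- The graph `BF(T,w)`: attach `w(e)` new triangles along each edge `e` of `T`. -/
def BFGraph {VT : Type} (T : SimpleGraph VT) (w : T.edgeSet → ℕ) :
    SimpleGraph (VT ⊕ (Σ e : T.edgeSet, Fin (w e))) :=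
  SimpleGraph.fromRel fun u v =>
    (∃ a b, u = Sum.inl a ∧ v = Sum.inl b ∧ T.Adj a b) ∨
    (∃ (a : VT) (e : T.edgeSet) (i : Fin (w e)), u = Sum.inl a ∧ v = Sum.inr ⟨e, i⟩ ∧
      a ∈ (e : Sym2 VT))

/-- The kite graph: the diamond (`K₄` minus the edge `{2,3}`) together with a pendant
vertex `4` attached to the degree-two vertex `2`. -/
def kite : SimpleGraph (Fin 5) :=
  SimpleGraph.fromEdgeSet {s(0,1), s(0,2), s(0,3), s(1,2), s(1,3), s(2,4)}

/-- The gem graph: the path `0-1-2-3` together with a vertex `4` adjacent to all of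
`0,1,2,3`. -/
def gem : SimpleGraph (Fin 5) :=
  SimpleGraph.fromEdgeSet {s(0,1), s(1,2), s(2,3), s(0,4), s(1,4), s(2,4), s(3,4)}

/-- The tadpole graph: the triangle `0,1,2` with a path `0-3-4` of length 2 attached. -/
def tadpole : SimpleGraph (Fin 5) :=
  SimpleGraph.fromEdgeSet {s(0,1), s(1,2), s(0,2), s(0,3), s(3,4)}

/-- The butterfly graph: two triangles `0,1,2` and `0,3,4` sharing the vertex `0`. -/
def butterfly : SimpleGraph (Fin 5) :=
  SimpleGraph.fromEdgeSet {s(0,1), s(1,2), s(0,2), s(0,3), s(3,4), s(0,4)}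

/-- The net graph: the triangle `0,1,2` with pendant vertices `3,4,5` attached to
`0,1,2` respectively. -/
def net : SimpleGraph (Fin 6) :=
  SimpleGraph.fromEdgeSet {s(0,1), s(1,2), s(0,2), s(0,3), s(1,4), s(2,5)}

/-! ### Consequences of being Lyubeznik for triples of generators -/

/-- Among any three generators, one of which divides the lcm of the other two, there are two whose
lcm is divisible by a generator ranked below both. -/
def TripleCondition {V : Type} (M : Finset (V → ℕ)) (ord : (V → ℕ) → ℕ) : Prop :=
  ∀ p ∈ M, ∀ q ∈ M, ∀ r ∈ M, q ≠ p → q ≠ r → q ≤ p ⊔ r →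
    ∃ m ∈ M, (m ≤ p ⊔ q ∧ ord m < ord p ∧ ord m < ord q) ∨
      (m ≤ q ⊔ r ∧ ord m < ord q ∧ ord m < ord r) ∨
      (m ≤ p ⊔ r ∧ ord m < ord p ∧ ord m < ord r)

theorem le_mlcm {V : Type} {σ : Finset (V → ℕ)} {g : V → ℕ} (hg : g ∈ σ) : g ≤ mlcm σ :=
  fun v => Finset.le_sup (f := fun g : V → ℕ => g v) hg

theorem mlcm_le {V : Type} {σ : Finset (V → ℕ)} {u : V → ℕ} (h : ∀ g ∈ σ, g ≤ u) :
    mlcm σ ≤ u :=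
  fun v => Finset.sup_le fun g hg => h g hg v

theorem IsLyubeznik.exists_tripleCondition {V : Type} {M : Finset (V → ℕ)}
    (h : IsLyubeznik M) : ∃ ord, TripleCondition M ord := by
  obtain ⟨ord, -, h⟩ := h
  refine ⟨ord, fun p hp q hq r hr hqp hqr hle => ?_⟩
  have hb : IsBridge {p, q, r} q := by
    refine ⟨by simp, le_antisymm (mlcm_le fun g hg => le_mlcm (Finset.mem_of_mem_erase hg))
      (mlcm_le ?_)⟩
    have hp' : p ∈ ({p, q, r} : Finset (V → ℕ)).erase q := by simp [hqp.symm]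
    have hr' : r ∈ ({p, q, r} : Finset (V → ℕ)).erase q := by simp [hqr.symm]
    intro g hg
    simp only [Finset.mem_insert, Finset.mem_singleton] at hg
    rcases hg with rfl | rfl | rfl
    · exact le_mlcm hp'
    · exact hle.trans (sup_le (le_mlcm hp') (le_mlcm hr'))
    · exact le_mlcm hr'
  have hc := fun hc => h _ hc q hb
  have hsub : ({p, q, r} : Finset (V → ℕ)) ⊆ M := by
    simp [Finset.insert_subset_iff, hp, hq, hr]
  obtain ⟨m, hm, t, ht, ⟨u, hu, htu⟩, hmt, hmle⟩ := not_not.1 fun hn => hc ⟨hsub, hn⟩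
  refine ⟨m, hm, ?_⟩
  have key : ∀ w : V → ℕ, (p ≤ w ∨ ord p < ord t) → (q ≤ w ∨ ord q < ord t) →
      (r ≤ w ∨ ord r < ord t) → m ≤ w := by
    intro w h1 h2 h3
    refine le_trans (show m ≤ _ from hmle) (mlcm_le fun g hg => ?_)
    simp only [Finset.mem_filter, Finset.mem_insert, Finset.mem_singleton] at hg
    obtain ⟨rfl | rfl | rfl, hg⟩ := hg
    · exact h1.resolve_right hg.not_gt
    · exact h2.resolve_right hg.not_gt
    · exact h3.resolve_right hg.not_gt
  simp only [Finset.mem_insert, Finset.mem_singleton] at ht hu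
  by_cases h1 : ord r < ord t
  · refine Or.inl ⟨key _ (.inl le_sup_left) (.inl le_sup_right) (.inr h1), ?_⟩
    rcases ht with rfl | rfl | rfl <;> rcases hu with rfl | rfl | rfl <;> omega
  by_cases h2 : ord p < ord t
  · refine Or.inr (Or.inl ⟨key _ (.inr h2) (.inl le_sup_left) (.inl le_sup_right), ?_⟩)
    rcases ht with rfl | rfl | rfl <;> rcases hu with rfl | rfl | rfl <;> omega
  · exact Or.inr (Or.inr ⟨key _ (.inl le_sup_left) (.inl hle) (.inl le_sup_right),
      by omega, by omega⟩)

/-! ### Generators of powers of edge ideals -/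

theorem mem_edgePowGens {V : Type} [Fintype V] {G : SimpleGraph V} {n : ℕ} {m : V → ℕ} :
    m ∈ edgePowGens G n ↔
      ∃ f : Fin n → Sym2 V, (∀ i, f i ∈ G.edgeSet) ∧ ∑ i, edgeMon (f i) = m := by
  simp [edgePowGens]

theorem add_mem_edgePowGens {V : Type} [Fintype V] {G : SimpleGraph V} {n k : ℕ}
    {a b : V → ℕ} (ha : a ∈ edgePowGens G n) (hb : b ∈ edgePowGens G k) :
    a + b ∈ edgePowGens G (n + k) := by
  rw [mem_edgePowGens] at *
  obtain ⟨f, hf, rfl⟩ := ha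
  obtain ⟨g, hg, rfl⟩ := hb
  refine ⟨Fin.append f g, fun i => ?_, by simp [Fin.sum_univ_add]⟩
  induction i using Fin.addCases <;> simp [hf, hg]

theorem nsmul_edgeMon_mem {V : Type} [Fintype V] {G : SimpleGraph V} {u v : V}
    (h : G.Adj u v) (k : ℕ) : k • edgeMon s(u, v) ∈ edgePowGens G k :=
  mem_edgePowGens.2 ⟨fun _ => s(u, v), fun _ => h, by simp⟩

theorem edgeMon_mk {V : Type} {u v : V} (h : u ≠ v) :
    edgeMon s(u, v) = Pi.single u 1 + Pi.single v 1 := by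
  ext w
  by_cases h1 : w = u <;> by_cases h2 : w = v <;> simp_all [edgeMon]

theorem sum_of_mem_edgePowGens {V : Type} [Fintype V] {G : SimpleGraph V} {n : ℕ}
    {m : V → ℕ} (hm : m ∈ edgePowGens G n) : ∑ v, m v = 2 * n := by
  obtain ⟨f, hf, rfl⟩ := mem_edgePowGens.1 hm
  have h : ∀ e ∈ G.edgeSet, ∑ v, edgeMon e v = 2 := by
    intro e
    induction e with | _ x y
    intro he
    simp [edgeMon_mk (G.ne_of_adj he), Finset.sum_add_distrib]
  simp only [Finset.sum_apply]
  rw [Finset.sum_comm]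
  simp [h _ (hf _), mul_comm]

theorem sum_le_of_isIndepSet {V : Type} [Fintype V] {G : SimpleGraph V} {n : ℕ}
    {m : V → ℕ} (hm : m ∈ edgePowGens G n) {A : Finset V}
    (hA : ∀ u ∈ A, ∀ v ∈ A, ¬ G.Adj u v) : ∑ v ∈ A, m v ≤ n := by
  obtain ⟨f, hf, rfl⟩ := mem_edgePowGens.1 hm
  have h : ∀ e ∈ G.edgeSet, ∑ v ∈ A, edgeMon e v ≤ 1 := by
    intro e
    induction e with | _ x y
    intro he
    have := fun hx hy => hA x hx y hy he
    simp only [edgeMon_mk (G.ne_of_adj he), Finset.sum_add_distrib, Pi.add_apply,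
      Finset.sum_pi_single']
    split_ifs <;> simp_all
  simp only [Finset.sum_apply]
  rw [Finset.sum_comm]
  simpa using Finset.sum_le_card_nsmul Finset.univ _ 1 fun i _ => h _ (hf i)

theorem edgeMon_map {V W : Type} (φ : W ↪ V) (e : Sym2 W) :
    edgeMon (e.map φ) = Function.extend φ (edgeMon e) 0 := by
  ext v
  by_cases hv : ∃ w, φ w = v
  · obtain ⟨w, rfl⟩ := hv
    simp [φ.injective.extend_apply, edgeMon, Sym2.mem_map]
  · rw [Function.extend_apply' _ _ _ hv]
    have : v ∉ e.map φ := fun h => hv (by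
      obtain ⟨w, -, h⟩ := Sym2.mem_map.1 h
      exact ⟨w, h⟩)
    simp [edgeMon, this]

theorem extend_mem_edgePowGens {V W : Type} [Fintype V] [Fintype W] {G : SimpleGraph V}
    (φ : W ↪ V) {n : ℕ} {a : W → ℕ} (ha : a ∈ edgePowGens (G.comap φ) n) :
    Function.extend φ a 0 ∈ edgePowGens G n := by
  obtain ⟨f, hf, rfl⟩ := mem_edgePowGens.1 ha
  have hmap : ∀ e ∈ (G.comap φ).edgeSet, e.map φ ∈ G.edgeSet := by
    intro e he
    induction e with | _ x y
    exact he
  refine mem_edgePowGens.2 ⟨fun i => (f i).map φ, fun i => hmap _ (hf i), ?_⟩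
  · ext v
    simp only [edgeMon_map, Finset.sum_apply]
    by_cases hv : ∃ w, φ w = v
    · obtain ⟨w, rfl⟩ := hv
      simp [φ.injective.extend_apply]
    · simp [Function.extend_apply' _ _ _ hv]

theorem comp_mem_edgePowGens {V W : Type} [Fintype V] [Fintype W] {G : SimpleGraph V}
    (φ : W ↪ V) {n : ℕ} {m : V → ℕ} (hm : m ∈ edgePowGens G n)
    (hsupp : ∀ v, m v ≠ 0 → v ∈ Set.range φ) : m ∘ φ ∈ edgePowGens (G.comap φ) n := by
  obtain ⟨f, hf, rfl⟩ := mem_edgePowGens.1 hm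
  have h : ∀ i, ∃ e ∈ (G.comap φ).edgeSet, e.map φ = f i := by
    intro i
    have hmem : ∀ v ∈ f i, v ∈ Set.range φ := by
      intro v hv
      refine hsupp v fun h0 => ?_
      rw [Finset.sum_apply, Finset.sum_eq_zero_iff] at h0
      simpa [edgeMon, hv] using h0 i (Finset.mem_univ i)
    have := hf i
    revert this hmem
    generalize f i = e
    induction e with | _ x y
    intro hmem hadj
    obtain ⟨a, rfl⟩ := hmem x (by simp)
    obtain ⟨b, rfl⟩ := hmem y (by simp)
    exact ⟨s(a, b), hadj, rfl⟩
  choose g hg hgf using h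
  refine mem_edgePowGens.2 ⟨g, hg, ?_⟩
  ext w
  simp [← hgf, edgeMon_map, φ.injective.extend_apply]

theorem TripleCondition.comap {V W : Type} [Fintype V] [Fintype W] {G : SimpleGraph V}
    (φ : W ↪ V) {n : ℕ} {ord : (V → ℕ) → ℕ} (h : TripleCondition (edgePowGens G n) ord) :
    TripleCondition (edgePowGens (G.comap φ) n) fun a => ord (Function.extend φ a 0) := by
  have hinj : Function.Injective fun a : W → ℕ => Function.extend φ a 0 :=
    Function.extend_injective φ.injective 0
  have hle : ∀ a b : W → ℕ, ∀ m ≤ Function.extend φ a 0 ⊔ Function.extend φ b 0,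
      (∀ v, m v ≠ 0 → v ∈ Set.range φ) ∧ m ∘ φ ≤ a ⊔ b := by
    intro a b m hm
    refine ⟨fun v hv => by_contra fun hv' => hv ?_, fun w => ?_⟩
    · simpa [Function.extend_apply' _ _ _ hv'] using hm v
    · simpa [φ.injective.extend_apply] using hm (φ w)
  have hext : ∀ m : V → ℕ, (∀ v, m v ≠ 0 → v ∈ Set.range φ) →
      Function.extend φ (m ∘ φ) 0 = m := by
    intro m hm
    ext v
    by_cases hv : ∃ w, φ w = v
    · obtain ⟨w, rfl⟩ := hv
      simp [φ.injective.extend_apply]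
    · rw [Function.extend_apply' _ _ _ hv]
      exact (not_not.1 fun h0 => hv (hm v (Ne.symm h0)))
  intro p hp q hq r hr hqp hqr hqle
  obtain ⟨m, hm, hcase⟩ := h _ (extend_mem_edgePowGens φ hp) _ (extend_mem_edgePowGens φ hq) _
    (extend_mem_edgePowGens φ hr) (hinj.ne hqp) (hinj.ne hqr) (by
      intro v
      by_cases hv : ∃ w, φ w = v
      · obtain ⟨w, rfl⟩ := hv
        simpa [φ.injective.extend_apply] using hqle w
      · simp [Function.extend_apply' _ _ _ hv])
  have hsupp : ∀ v, m v ≠ 0 → v ∈ Set.range φ := by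
    rcases hcase with hc | hc | hc <;> exact (hle _ _ m hc.1).1
  refine ⟨m ∘ φ, comp_mem_edgePowGens φ hm hsupp, ?_⟩
  simp only [hext m hsupp]
  exact hcase.imp (fun hc => ⟨(hle _ _ m hc.1).2, hc.2⟩)
    (Or.imp (fun hc => ⟨(hle _ _ m hc.1).2, hc.2⟩) fun hc => ⟨(hle _ _ m hc.1).2, hc.2⟩)

/-! ### Obstructions on three and four vertices -/

theorem TripleCondition.fin_three {M : Finset (Fin 3 → ℕ)} {ord : (Fin 3 → ℕ) → ℕ}
    (h : TripleCondition M ord) {p₀ p₁ p₂ q₀ q₁ q₂ r₀ r₁ r₂ : ℕ}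
    (hp : ![p₀, p₁, p₂] ∈ M) (hq : ![q₀, q₁, q₂] ∈ M) (hr : ![r₀, r₁, r₂] ∈ M)
    (hqp : ![q₀, q₁, q₂] ≠ ![p₀, p₁, p₂]) (hqr : ![q₀, q₁, q₂] ≠ ![r₀, r₁, r₂])
    (hle : q₀ ≤ max p₀ r₀ ∧ q₁ ≤ max p₁ r₁ ∧ q₂ ≤ max p₂ r₂) :
    ∃ a b c, ![a, b, c] ∈ M ∧
      (((a ≤ max p₀ q₀ ∧ b ≤ max p₁ q₁ ∧ c ≤ max p₂ q₂) ∧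
          ord ![a, b, c] < ord ![p₀, p₁, p₂] ∧ ord ![a, b, c] < ord ![q₀, q₁, q₂]) ∨
        ((a ≤ max q₀ r₀ ∧ b ≤ max q₁ r₁ ∧ c ≤ max q₂ r₂) ∧
          ord ![a, b, c] < ord ![q₀, q₁, q₂] ∧ ord ![a, b, c] < ord ![r₀, r₁, r₂]) ∨
        ((a ≤ max p₀ r₀ ∧ b ≤ max p₁ r₁ ∧ c ≤ max p₂ r₂) ∧
          ord ![a, b, c] < ord ![p₀, p₁, p₂] ∧ ord ![a, b, c] < ord ![r₀, r₁, r₂])) := by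
  obtain ⟨m, hm, hcase⟩ := h _ hp _ hq _ hr hqp hqr (by
    simpa [Pi.le_def, Fin.forall_fin_succ] using hle)
  have hm' : m = ![m 0, m 1, m 2] := by
    ext i
    fin_cases i <;> rfl
  refine ⟨m 0, m 1, m 2, hm' ▸ hm, ?_⟩
  rw [← hm']
  simpa [Pi.le_def, Fin.forall_fin_succ] using hcase

theorem TripleCondition.fin_four {M : Finset (Fin 4 → ℕ)} {ord : (Fin 4 → ℕ) → ℕ}
    (h : TripleCondition M ord) {p₀ p₁ p₂ p₃ q₀ q₁ q₂ q₃ r₀ r₁ r₂ r₃ : ℕ}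
    (hp : ![p₀, p₁, p₂, p₃] ∈ M) (hq : ![q₀, q₁, q₂, q₃] ∈ M) (hr : ![r₀, r₁, r₂, r₃] ∈ M)
    (hqp : ![q₀, q₁, q₂, q₃] ≠ ![p₀, p₁, p₂, p₃])
    (hqr : ![q₀, q₁, q₂, q₃] ≠ ![r₀, r₁, r₂, r₃])
    (hle : q₀ ≤ max p₀ r₀ ∧ q₁ ≤ max p₁ r₁ ∧ q₂ ≤ max p₂ r₂ ∧ q₃ ≤ max p₃ r₃) :
    ∃ a b c d, ![a, b, c, d] ∈ M ∧
      (((a ≤ max p₀ q₀ ∧ b ≤ max p₁ q₁ ∧ c ≤ max p₂ q₂ ∧ d ≤ max p₃ q₃) ∧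
          ord ![a, b, c, d] < ord ![p₀, p₁, p₂, p₃] ∧
          ord ![a, b, c, d] < ord ![q₀, q₁, q₂, q₃]) ∨
        ((a ≤ max q₀ r₀ ∧ b ≤ max q₁ r₁ ∧ c ≤ max q₂ r₂ ∧ d ≤ max q₃ r₃) ∧
          ord ![a, b, c, d] < ord ![q₀, q₁, q₂, q₃] ∧
          ord ![a, b, c, d] < ord ![r₀, r₁, r₂, r₃]) ∨
        ((a ≤ max p₀ r₀ ∧ b ≤ max p₁ r₁ ∧ c ≤ max p₂ r₂ ∧ d ≤ max p₃ r₃) ∧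
          ord ![a, b, c, d] < ord ![p₀, p₁, p₂, p₃] ∧
          ord ![a, b, c, d] < ord ![r₀, r₁, r₂, r₃])) := by
  obtain ⟨m, hm, hcase⟩ := h _ hp _ hq _ hr hqp hqr (by
    simpa [Pi.le_def, Fin.forall_fin_succ] using hle)
  have hm' : m = ![m 0, m 1, m 2, m 3] := by
    ext i
    fin_cases i <;> rfl
  refine ⟨m 0, m 1, m 2, m 3, hm' ▸ hm, ?_⟩
  rw [← hm']
  simpa [Pi.le_def, Fin.forall_fin_succ] using hcase

theorem edgeMon_add_edgeMon_mem {V : Type} [Fintype V] {G : SimpleGraph V} {u v w x : V}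
    (h : G.Adj u v) (h' : G.Adj w x) :
    edgeMon s(u, v) + edgeMon s(w, x) ∈ edgePowGens G 2 := by
  simpa using add_mem_edgePowGens (nsmul_edgeMon_mem h 1) (nsmul_edgeMon_mem h' 1)

/-- The square of the edge ideal of the claw is not Lyubeznik. -/
theorem not_tripleCondition_of_claw {H : SimpleGraph (Fin 4)} (h₁ : H.Adj 0 1)
    (h₂ : H.Adj 0 2) (h₃ : H.Adj 0 3) (h₁₂ : ¬ H.Adj 1 2) (h₁₃ : ¬ H.Adj 1 3)
    (h₂₃ : ¬ H.Adj 2 3) (ord : (Fin 4 → ℕ) → ℕ) :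
    ¬ TripleCondition (edgePowGens H 2) ord := by
  intro h
  have key : ∀ a b c d, ![a, b, c, d] ∈ edgePowGens H 2 → a = 2 ∧ b + c + d = 2 := by
    intro a b c d hm
    have e1 := sum_of_mem_edgePowGens hm
    have e2 := sum_le_of_isIndepSet hm (A := {0}) (by simp)
    have e3 := sum_le_of_isIndepSet hm (A := {1, 2, 3})
      (by simp [h₁₂, h₁₃, h₂₃, H.adj_comm 2 1, H.adj_comm 3 1, H.adj_comm 3 2])
    simp [Fin.sum_univ_four] at e1 e2 e3
    omega
  have m200 : ![2, 2, 0, 0] ∈ edgePowGens H 2 := by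
    convert edgeMon_add_edgeMon_mem h₁ h₁ using 1
    ext i; fin_cases i <;> simp [edgeMon]
  have m020 : ![2, 0, 2, 0] ∈ edgePowGens H 2 := by
    convert edgeMon_add_edgeMon_mem h₂ h₂ using 1
    ext i; fin_cases i <;> simp [edgeMon]
  have m002 : ![2, 0, 0, 2] ∈ edgePowGens H 2 := by
    convert edgeMon_add_edgeMon_mem h₃ h₃ using 1
    ext i; fin_cases i <;> simp [edgeMon]
  have m110 : ![2, 1, 1, 0] ∈ edgePowGens H 2 := by
    convert edgeMon_add_edgeMon_mem h₁ h₂ using 1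
    ext i; fin_cases i <;> simp [edgeMon]
  have m101 : ![2, 1, 0, 1] ∈ edgePowGens H 2 := by
    convert edgeMon_add_edgeMon_mem h₁ h₃ using 1
    ext i; fin_cases i <;> simp [edgeMon]
  have m011 : ![2, 0, 1, 1] ∈ edgePowGens H 2 := by
    convert edgeMon_add_edgeMon_mem h₂ h₃ using 1
    ext i; fin_cases i <;> simp [edgeMon]
  have k1 : ord ![2, 1, 0, 1] < ord ![2, 1, 1, 0] ∨ ord ![2, 0, 1, 1] < ord ![2, 1, 1, 0] := by
    obtain ⟨a, b, c, d, hm, hcase⟩ := h.fin_four m002 m101 m110 (by simp) (by simp) (by simp)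
    obtain ⟨rfl, hs⟩ := key _ _ _ _ hm
    have hb : b ≤ 1 := by omega
    have hc : c ≤ 1 := by omega
    obtain rfl : d = 2 - b - c := by omega
    interval_cases b <;> interval_cases c <;> simp at hcase ⊢ <;> omega
  have k2 : ord ![2, 1, 1, 0] < ord ![2, 0, 1, 1] ∨ ord ![2, 1, 0, 1] < ord ![2, 0, 1, 1] := by
    obtain ⟨a, b, c, d, hm, hcase⟩ := h.fin_four m200 m110 m011 (by simp) (by simp) (by simp)
    obtain ⟨rfl, hs⟩ := key _ _ _ _ hm
    have hb : d ≤ 1 := by omega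
    have hc : c ≤ 1 := by omega
    obtain rfl : b = 2 - d - c := by omega
    interval_cases d <;> interval_cases c <;> simp at hcase ⊢ <;> omega
  have k3 : ord ![2, 0, 1, 1] < ord ![2, 1, 0, 1] ∨ ord ![2, 1, 1, 0] < ord ![2, 1, 0, 1] := by
    obtain ⟨a, b, c, d, hm, hcase⟩ := h.fin_four m020 m011 m101 (by simp) (by simp) (by simp)
    obtain ⟨rfl, hs⟩ := key _ _ _ _ hm
    have hb : b ≤ 1 := by omega
    have hc : d ≤ 1 := by omega
    obtain rfl : c = 2 - b - d := by omega
    interval_cases b <;> interval_cases d <;> simp at hcase ⊢ <;> omega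
  omega

/-- The square of the edge ideal of a path or cycle on four vertices is not Lyubeznik. -/
theorem not_tripleCondition_of_path {H : SimpleGraph (Fin 4)} (h₁ : H.Adj 0 1)
    (h₂ : H.Adj 1 2) (h₃ : H.Adj 2 3) (h₀₂ : ¬ H.Adj 0 2) (h₁₃ : ¬ H.Adj 1 3)
    (ord : (Fin 4 → ℕ) → ℕ) : ¬ TripleCondition (edgePowGens H 2) ord := by
  intro h
  have key : ∀ a b c d, ![a, b, c, d] ∈ edgePowGens H 2 → a + c = 2 ∧ b + d = 2 := by
    intro a b c d hm
    have e1 := sum_of_mem_edgePowGens hm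
    have e2 := sum_le_of_isIndepSet hm (A := {0, 2}) (by simp [h₀₂, H.adj_comm 2 0])
    have e3 := sum_le_of_isIndepSet hm (A := {1, 3}) (by simp [h₁₃, H.adj_comm 3 1])
    simp [Fin.sum_univ_four] at e1 e2 e3
    omega
  have maa : ![2, 2, 0, 0] ∈ edgePowGens H 2 := by
    convert edgeMon_add_edgeMon_mem h₁ h₁ using 1
    ext i; fin_cases i <;> simp [edgeMon]
  have mab : ![1, 2, 1, 0] ∈ edgePowGens H 2 := by
    convert edgeMon_add_edgeMon_mem h₁ h₂ using 1
    ext i; fin_cases i <;> simp [edgeMon]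
  have mbb : ![0, 2, 2, 0] ∈ edgePowGens H 2 := by
    convert edgeMon_add_edgeMon_mem h₂ h₂ using 1
    ext i; fin_cases i <;> simp [edgeMon]
  have mac : ![1, 1, 1, 1] ∈ edgePowGens H 2 := by
    convert edgeMon_add_edgeMon_mem h₁ h₃ using 1
    ext i; fin_cases i <;> simp [edgeMon]
  have mbc : ![0, 1, 2, 1] ∈ edgePowGens H 2 := by
    convert edgeMon_add_edgeMon_mem h₂ h₃ using 1
    ext i; fin_cases i <;> simp [edgeMon]
  have k1 : ord ![1, 2, 1, 0] < ord ![0, 2, 2, 0] := by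
    obtain ⟨a, b, c, d, hm, hcase⟩ := h.fin_four maa mab mbb (by simp) (by simp) (by simp)
    obtain ⟨hs, hs'⟩ := key _ _ _ _ hm
    obtain rfl : d = 0 := by omega
    obtain rfl : b = 2 := by omega
    obtain rfl : c = 2 - a := by omega
    have ha : a ≤ 2 := by omega
    interval_cases a <;> simp at hcase ⊢
    all_goals omega
  have k2 : ord ![1, 1, 1, 1] < ord ![1, 2, 1, 0] ∧ ord ![1, 1, 1, 1] < ord ![0, 1, 2, 1] ∨
      ord ![0, 2, 2, 0] < ord ![1, 2, 1, 0] := by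
    obtain ⟨a, b, c, d, hm, hcase⟩ := h.fin_four mab mac mbc (by simp) (by simp) (by simp)
    obtain ⟨hs, hs'⟩ := key _ _ _ _ hm
    obtain rfl : b = 2 - d := by omega
    obtain rfl : c = 2 - a := by omega
    have ha : a ≤ 1 := by omega
    have hd : d ≤ 1 := by omega
    interval_cases a <;> interval_cases d <;> simp at hcase ⊢ <;> omega
  have k3 : ord ![1, 2, 1, 0] < ord ![1, 1, 1, 1] ∨ ord ![0, 1, 2, 1] < ord ![1, 1, 1, 1] := by
    obtain ⟨a, b, c, d, hm, hcase⟩ := h.fin_four mac mab mbb (by simp) (by simp) (by simp)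
    obtain ⟨hs, hs'⟩ := key _ _ _ _ hm
    obtain rfl : b = 2 - d := by omega
    obtain rfl : c = 2 - a := by omega
    have ha : a ≤ 1 := by omega
    have hd : d ≤ 1 := by omega
    interval_cases a <;> interval_cases d <;> simp at hcase ⊢ <;> omega
  omega

/-- Powers at least the third of the edge ideal of a path on three vertices are not Lyubeznik. -/
theorem not_tripleCondition_of_cherry {H : SimpleGraph (Fin 3)} (h₁ : H.Adj 0 1)
    (h₂ : H.Adj 0 2) (h₁₂ : ¬ H.Adj 1 2) (k : ℕ) (ord : (Fin 3 → ℕ) → ℕ) :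
    ¬ TripleCondition (edgePowGens H (k + 3)) ord := by
  intro h
  have key : ∀ a b c, ![a, b, c] ∈ edgePowGens H (k + 3) → a = k + 3 ∧ b + c = k + 3 := by
    intro a b c hm
    have e1 := sum_of_mem_edgePowGens hm
    have e2 := sum_le_of_isIndepSet hm (A := {0}) (by simp)
    have e3 := sum_le_of_isIndepSet hm (A := {1, 2}) (by simp [h₁₂, H.adj_comm 2 1])
    simp [Fin.sum_univ_three] at e1 e2 e3
    omega
  have hmem : ∀ i ≤ 3, ![k + 3, k + i, 3 - i] ∈ edgePowGens H (k + 3) := by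
    intro i hi
    have hm := add_mem_edgePowGens (nsmul_edgeMon_mem h₁ (k + i)) (nsmul_edgeMon_mem h₂ (3 - i))
    have hk : k + i + (3 - i) = k + 3 := by omega
    rw [hk] at hm
    convert hm using 1
    ext j
    fin_cases j <;> simp [edgeMon]
    omega
  have m0 := hmem 0 (by simp)
  have m1 := hmem 1 (by simp)
  have m2 := hmem 2 (by simp)
  have m3 := hmem 3 (by simp)
  simp only [add_zero, tsub_zero, Nat.reduceSub] at m0 m1 m2 m3
  have k1 : ord ![k + 3, k + 1, 2] < ord ![k + 3, k + 2, 1] := by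
    obtain ⟨a, b, c, hm, hcase⟩ := h.fin_three m0 m1 m2 (by simp) (by simp) (by simp)
    obtain ⟨rfl, hs⟩ := key _ _ _ hm
    obtain ⟨j, rfl⟩ : ∃ j, b = k + j := ⟨b - k, by omega⟩
    obtain rfl : c = 3 - j := by omega
    have hj : j ≤ 2 := by omega
    interval_cases j <;> simp at hcase ⊢
    all_goals omega
  have k2 : ord ![k + 3, k + 2, 1] < ord ![k + 3, k + 1, 2] := by
    obtain ⟨a, b, c, hm, hcase⟩ := h.fin_three m1 m2 m3 (by simp) (by simp) (by simp)
    obtain ⟨rfl, hs⟩ := key _ _ _ hm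
    obtain ⟨j, rfl⟩ : ∃ j, b = k + j := ⟨b - k, by omega⟩
    obtain rfl : c = 3 - j := by omega
    have hj : j ≤ 3 := by omega
    interval_cases j <;> simp at hcase ⊢
    all_goals omega
  omega

/-- Powers at least the second of the edge ideal of a triangle are not Lyubeznik. -/
theorem not_tripleCondition_of_triangle {H : SimpleGraph (Fin 3)} (h₀₁ : H.Adj 0 1)
    (h₀₂ : H.Adj 0 2) (h₁₂ : H.Adj 1 2) (k : ℕ) (ord : (Fin 3 → ℕ) → ℕ) :
    ¬ TripleCondition (edgePowGens H (k + 2)) ord := by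
  intro h
  have key : ∀ a b c, ![a, b, c] ∈ edgePowGens H (k + 2) →
      a + b + c = 2 * (k + 2) ∧ a ≤ k + 2 ∧ b ≤ k + 2 ∧ c ≤ k + 2 := by
    intro a b c hm
    have e1 := sum_of_mem_edgePowGens hm
    have e2 := sum_le_of_isIndepSet hm (A := {0}) (by simp)
    have e3 := sum_le_of_isIndepSet hm (A := {1}) (by simp)
    have e4 := sum_le_of_isIndepSet hm (A := {2}) (by simp)
    simp [Fin.sum_univ_three] at e1 e2 e3 e4
    omega
  have hmem : ∀ {u v w x}, H.Adj u v → H.Adj w x →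
      k • edgeMon s(0, 1) + (edgeMon s(u, v) + edgeMon s(w, x)) ∈ edgePowGens H (k + 2) :=
    fun h h' => add_mem_edgePowGens (nsmul_edgeMon_mem h₀₁ k) (edgeMon_add_edgeMon_mem h h')
  have hmem' : ∀ i j l, i + j + l = 4 ∧ i ≤ 2 ∧ j ≤ 2 ∧ l ≤ 2 →
      ![k + i, k + j, l] ∈ edgePowGens H (k + 2) := by
    rintro i j l ⟨hs, hi, hj, hl⟩
    obtain rfl : l = 4 - i - j := by omega
    have h' : ∀ {u v w x}, H.Adj u v → H.Adj w x →
        ![k + i, k + j, 4 - i - j] =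
          k • edgeMon s(0, 1) + (edgeMon s(u, v) + edgeMon s(w, x)) →
        ![k + i, k + j, 4 - i - j] ∈ edgePowGens H (k + 2) :=
      fun h h' he => he ▸ hmem h h'
    interval_cases i <;> interval_cases j <;> try omega
    · exact h' h₁₂ h₁₂ (by ext i; fin_cases i <;> simp [edgeMon])
    · exact h' h₀₂ h₁₂ (by ext i; fin_cases i <;> simp [edgeMon])
    · exact h' h₀₁ h₁₂ (by ext i; fin_cases i <;> simp [edgeMon])
    · exact h' h₀₂ h₀₂ (by ext i; fin_cases i <;> simp [edgeMon])
    · exact h' h₀₁ h₀₂ (by ext i; fin_cases i <;> simp [edgeMon])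
    · exact h' h₀₁ h₀₁ (by ext i; fin_cases i <;> simp [edgeMon])
  obtain ⟨F, hF⟩ : ∃ F : ℕ → ℕ → ℕ → ℕ, ∀ i j l, ord ![k + i, k + j, l] = F i j l :=
    ⟨_, fun _ _ _ => rfl⟩
  obtain ⟨⟨x, y, z⟩, hxyz, hmin⟩ := Finset.exists_min_image
    ((Finset.range 3 ×ˢ Finset.range 3 ×ˢ Finset.range 3).filter
      fun t : ℕ × ℕ × ℕ => t.1 + t.2.1 + t.2.2 = 4) (fun t => F t.1 t.2.1 t.2.2)
    ⟨(2, 2, 0), by simp⟩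
  simp only [Finset.mem_filter, Finset.mem_product, Finset.mem_range, Prod.forall] at hxyz hmin
  have tri : ∀ i j l i' j' l', i + j + l = 4 ∧ i ≤ 2 ∧ j ≤ 2 ∧ l ≤ 2 →
      i' + j' + l' = 4 ∧ i' ≤ 2 ∧ j' ≤ 2 ∧ l' ≤ 2 →
      (i ≠ x ∨ j ≠ y) → (i ≠ i' ∨ j ≠ j') → i ≤ max x i' ∧ j ≤ max y j' ∧ l ≤ max z l' →
      ∃ a b c, (a + b + c = 4 ∧ a ≤ 2 ∧ b ≤ 2 ∧ c ≤ 2) ∧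
        (a ≤ max i i' ∧ b ≤ max j j' ∧ c ≤ max l l') ∧
        F a b c < F i j l ∧ F a b c < F i' j' l' := by
    intro i j l i' j' l' hq hr hne hne' hle
    obtain ⟨a, b, c, hm, hcase⟩ := h.fin_three (hmem' x y z (by omega)) (hmem' i j l hq)
      (hmem' i' j' l' hr)
      (fun he => by have e0 := congrFun he 0; have e1 := congrFun he 1; simp at e0 e1; omega)
      (fun he => by have e0 := congrFun he 0; have e1 := congrFun he 1; simp at e0 e1; omega)
      (by omega)
    obtain ⟨hs, ha, hb, hc⟩ := key _ _ _ hm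
    have hc2 : c ≤ 2 := by omega
    obtain ⟨a, rfl⟩ : ∃ a', a = k + a' := ⟨a - k, by omega⟩
    obtain ⟨b, rfl⟩ : ∃ b', b = k + b' := ⟨b - k, by omega⟩
    simp only [hF] at hcase
    have := hmin a b c (by omega)
    exact ⟨a, b, c, by omega, by omega, by omega⟩
  obtain ⟨hlt, hs⟩ := hxyz
  obtain rfl : z = 4 - x - y := by omega
  have hx : x ≤ 2 := by omega
  have hy : y ≤ 2 := by omega
  have contra : ∀ i j l i' j' l' i'' j'' l'',
      (∃ a b c, (a + b + c = 4 ∧ a ≤ 2 ∧ b ≤ 2 ∧ c ≤ 2) ∧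
        (a ≤ max i i' ∧ b ≤ max j j' ∧ c ≤ max l l') ∧
        F a b c < F i j l ∧ F a b c < F i' j' l') →
      (∃ a b c, (a + b + c = 4 ∧ a ≤ 2 ∧ b ≤ 2 ∧ c ≤ 2) ∧
        (a ≤ max i'' i' ∧ b ≤ max j'' j' ∧ c ≤ max l'' l') ∧
        F a b c < F i'' j'' l'' ∧ F a b c < F i' j' l') →
      (∀ a b c, a + b + c = 4 → a ≤ 2 → b ≤ 2 → c ≤ 2 →
        ((a ≤ max i i' ∧ b ≤ max j j' ∧ c ≤ max l l') ∨
          (a ≤ max i'' i' ∧ b ≤ max j'' j' ∧ c ≤ max l'' l')) →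
        (a = i ∧ b = j ∧ c = l) ∨ (a = i' ∧ b = j' ∧ c = l') ∨ (a = i'' ∧ b = j'' ∧ c = l'')) →
      False := by
    rintro i j l i' j' l' i'' j'' l'' ⟨a, b, c, ⟨h1, h2, h3, h4⟩, h5, h6, h7⟩
      ⟨a', b', c', ⟨h1', h2', h3', h4'⟩, h5', h6', h7'⟩ hall
    rcases hall a b c h1 h2 h3 h4 (.inl h5) with ⟨rfl, rfl, rfl⟩ | ⟨rfl, rfl, rfl⟩ | ⟨rfl, rfl, rfl⟩
    · omega
    · omega
    rcases hall a' b' c' h1' h2' h3' h4' (.inr h5') with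
      ⟨rfl, rfl, rfl⟩ | ⟨rfl, rfl, rfl⟩ | ⟨rfl, rfl, rfl⟩ <;> omega
  interval_cases x <;> interval_cases y <;> try omega
  all_goals first
    | (refine contra 1 2 1 2 2 0 2 1 1 (tri _ _ _ _ _ _ ?_ ?_ ?_ ?_ ?_)
        (tri _ _ _ _ _ _ ?_ ?_ ?_ ?_ ?_) ?_ <;> omega)
    | (refine contra 2 1 1 2 0 2 1 1 2 (tri _ _ _ _ _ _ ?_ ?_ ?_ ?_ ?_)
        (tri _ _ _ _ _ _ ?_ ?_ ?_ ?_ ?_) ?_ <;> omega)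
    | (refine contra 1 2 1 0 2 2 1 1 2 (tri _ _ _ _ _ _ ?_ ?_ ?_ ?_ ?_)
        (tri _ _ _ _ _ _ ?_ ?_ ?_ ?_ ?_) ?_ <;> omega)

/-! ### Small graphs -/

theorem exists_adj_notMem {V : Type} {G : SimpleGraph V} (hconn : G.Connected) {S : Set V}
    {u v : V} (hu : u ∈ S) (hv : v ∉ S) : ∃ a ∈ S, ∃ b ∉ S, G.Adj a b := by
  obtain ⟨p⟩ := hconn.preconnected u v
  obtain ⟨d, -, h1, h2⟩ := p.exists_boundary_dart S hu hv
  exact ⟨_, h1, _, h2, d.adj⟩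

theorem nonempty_iso_pathGraph_two {V : Type} {G : SimpleGraph V} {x c : V} (h : G.Adj x c)
    (hall : ∀ v, v = x ∨ v = c) : Nonempty (G ≃g SimpleGraph.pathGraph 2) := by
  have hne := h.ne
  have hbij : Function.Bijective ![x, c] := by
    refine ⟨fun i j => ?_, fun v => ?_⟩
    · fin_cases i <;> fin_cases j <;> simp [hne, hne.symm]
    · rcases hall v with rfl | rfl
      exacts [⟨0, rfl⟩, ⟨1, rfl⟩]
  refine ⟨SimpleGraph.Iso.symm ⟨Equiv.ofBijective _ hbij, fun {i j} => ?_⟩⟩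
  fin_cases i <;> fin_cases j <;> simp [SimpleGraph.pathGraph_adj, h, h.symm]

theorem nonempty_iso_pathGraph_three {V : Type} {G : SimpleGraph V} {x c y : V}
    (h : G.Adj x c) (h' : G.Adj c y) (hxy : x ≠ y) (hn : ¬ G.Adj x y)
    (hall : ∀ v, v = x ∨ v = c ∨ v = y) : Nonempty (G ≃g SimpleGraph.pathGraph 3) := by
  have hne := h.ne
  have hne' := h'.ne
  have hn' : ¬ G.Adj y x := fun h => hn h.symm
  have hbij : Function.Bijective ![x, c, y] := by
    refine ⟨fun i j => ?_, fun v => ?_⟩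
    · fin_cases i <;> fin_cases j <;> simp [hne, hne.symm, hne', hne'.symm, hxy, hxy.symm]
    · rcases hall v with rfl | rfl | rfl
      exacts [⟨0, rfl⟩, ⟨1, rfl⟩, ⟨2, rfl⟩]
  refine ⟨SimpleGraph.Iso.symm ⟨Equiv.ofBijective _ hbij, fun {i j} => ?_⟩⟩
  fin_cases i <;> fin_cases j <;>
    simp [SimpleGraph.pathGraph_adj, h, h.symm, h', h'.symm, hn, hn']

theorem IsBridge.exists_le {V : Type} {σ : Finset (V → ℕ)} {b : V → ℕ} (hb : IsBridge σ b)
    {v : V} (hv : b v ≠ 0) : ∃ g ∈ σ, g ≠ b ∧ b v ≤ g v := by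
  have hle : b v ≤ mlcm (σ.erase b) v := by
    rw [hb.2]
    exact le_mlcm hb.1 v
  obtain ⟨g, hg, hgv⟩ := (Finset.le_sup_iff (Nat.pos_of_ne_zero hv)).1 hle
  rw [Finset.mem_erase] at hg
  exact ⟨g, hg.2, hg.1, hgv⟩

theorem isLyubeznik_of_iso_pathGraph_two {V : Type} [Fintype V] {G : SimpleGraph V}
    (e : G ≃g SimpleGraph.pathGraph 2) {n : ℕ} (hn : n ≠ 0) :
    IsLyubeznik (edgePowGens G n) := by
  have key : ∀ m ∈ edgePowGens G n, ∀ v, m v = n := by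
    intro m hm v
    have hall : ∀ i, m (e.symm i) ≤ n := by
      intro i
      simpa using sum_le_of_isIndepSet hm (A := {e.symm i}) (by simp)
    have hs := sum_of_mem_edgePowGens hm
    rw [← e.symm.toEquiv.sum_comp, Fin.sum_univ_two] at hs
    have h0 := hall 0
    have h1 := hall 1
    have h2 : ∀ i, m (e.symm i) = n := by
      intro i
      fin_cases i
      · change m (e.symm 0) + m (e.symm 1) = _ at hs
        change m (e.symm 0) = n
        omega
      · change m (e.symm 0) + m (e.symm 1) = _ at hs
        change m (e.symm 1) = n
        omega
    simpa using h2 (e v)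
  have hsub : ∀ a ∈ edgePowGens G n, ∀ b ∈ edgePowGens G n, a = b :=
    fun a ha b hb => funext fun v => (key a ha v).trans (key b hb v).symm
  refine ⟨fun _ => 0, fun a ha b hb _ => hsub a ha b hb, fun σ hσ b hb => ?_⟩
  obtain ⟨g, hg, hne, -⟩ := hb.exists_le (v := e.symm 0) (by rwa [key b (hσ.1 hb.1)])
  exact hne (hsub g (hσ.1 hg) b (hσ.1 hb.1))

theorem isLyubeznik_of_iso_pathGraph_three {V : Type} [Fintype V] {G : SimpleGraph V}
    (e : G ≃g SimpleGraph.pathGraph 3) : IsLyubeznik (edgePowGens G 2) := by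
  obtain ⟨x, hx⟩ : ∃ x, x = e.symm 0 := ⟨_, rfl⟩
  obtain ⟨c, hc⟩ : ∃ c, c = e.symm 1 := ⟨_, rfl⟩
  obtain ⟨y, hy⟩ : ∃ y, y = e.symm 2 := ⟨_, rfl⟩
  have hall : ∀ v, v = x ∨ v = c ∨ v = y := by
    intro v
    obtain ⟨i, rfl⟩ := e.symm.surjective v
    fin_cases i <;> simp [hx, hc, hy]
  have hxy : x ≠ y := by simp [hx, hy]
  have hnadj : ¬ G.Adj x y := by
    rw [hx, hy, e.symm.map_adj_iff, SimpleGraph.pathGraph_adj]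
    simp
  have key : ∀ m ∈ edgePowGens G 2, m c = 2 ∧ m x + m y = 2 := by
    intro m hm
    have h1 := sum_of_mem_edgePowGens hm
    have h2 := sum_le_of_isIndepSet hm (A := {c}) (by simp)
    have h3 := sum_le_of_isIndepSet hm (A := {x, y}) (by simp [hnadj, G.adj_comm y x])
    rw [← e.symm.toEquiv.sum_comp, Fin.sum_univ_three] at h1
    change m (e.symm 0) + m (e.symm 1) + m (e.symm 2) = _ at h1
    rw [← hx, ← hc, ← hy] at h1
    rw [Finset.sum_pair hxy] at h3
    rw [Finset.sum_singleton] at h2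
    omega
  have hext : ∀ a ∈ edgePowGens G 2, ∀ b ∈ edgePowGens G 2, a x = b x → a = b := by
    intro a ha b hb hab
    have ha := key a ha
    have hb := key b hb
    ext v
    rcases hall v with rfl | rfl | rfl <;> omega
  refine ⟨fun m => if m x = 1 then 0 else 1 + m x, fun a ha b hb hab => hext a ha b hb ?_,
    fun σ hσ b hb => ?_⟩
  · dsimp only at hab
    split_ifs at hab <;> omega
  have hbM := hσ.1 hb.1
  obtain ⟨hbc, hbxy⟩ := key b hbM
  have hgx : b x ≠ 0 → ∃ g ∈ σ, b x < g x := by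
    intro h
    obtain ⟨g, hg, hne, hle⟩ := hb.exists_le h
    exact ⟨g, hg, lt_of_le_of_ne hle fun h => hne (hext g (hσ.1 hg) b hbM h.symm)⟩
  have hhy : b y ≠ 0 → ∃ g ∈ σ, g x < b x := by
    intro h
    obtain ⟨g, hg, hne, hle⟩ := hb.exists_le h
    have := key g (hσ.1 hg)
    exact ⟨g, hg, lt_of_le_of_ne (by omega) fun h => hne (hext g (hσ.1 hg) b hbM h)⟩
  have hb0 : b x ≠ 0 := by
    intro h0
    obtain ⟨g, -, hg⟩ := hhy (by omega)
    omega
  obtain ⟨g, hg, hgb⟩ := hgx hb0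
  have hgk := key g (hσ.1 hg)
  obtain ⟨h, hh, hhb⟩ := hhy (by omega)
  have hhk := key h (hσ.1 hh)
  have hb1 : b x = 1 := by omega
  have hg2 : g x = 2 := by omega
  have hh0 : h x = 0 := by omega
  have hgle := le_mlcm (σ := σ.filter fun w => (if h x = 1 then 0 else 1 + h x) ≤
    if w x = 1 then 0 else 1 + w x) (g := g) (by simp [hg, hg2, hh0])
  have hhle := le_mlcm (σ := σ.filter fun w => (if h x = 1 then 0 else 1 + h x) ≤
    if w x = 1 then 0 else 1 + w x) (g := h) (by simp [hh])
  refine hσ.2 ⟨b, hbM, h, hh, ⟨g, hg, by simp [hg2, hh0]⟩, by simp [hb1, hh0], fun v => ?_⟩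
  rcases hall v with rfl | rfl | rfl
  · exact le_trans (by omega) (hgle _)
  · exact le_trans (by omega) (hgle _)
  · exact le_trans (by omega) (hhle _)

/-- **Theorem 3.10.** For a finite connected simple graph `G` with at least one edge
and `n ≥ 2`, the ideal `I(G)^n` is Lyubeznik iff `G` is a single edge, or `n = 2` and
`G` is a path of length 2. -/
theorem edgeIdealPow_isLyubeznik_iff {V : Type} [Fintype V] (G : SimpleGraph V)
    (hconn : G.Connected) (hedge : G.edgeSet.Nonempty) (n : ℕ) (hn : 2 ≤ n) :
    IsLyubeznik (edgePowGens G n) ↔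
      Nonempty (G ≃g SimpleGraph.pathGraph 2) ∨
        (n = 2 ∧ Nonempty (G ≃g SimpleGraph.pathGraph 3)) := by
  constructor
  swap
  · rintro (⟨⟨e⟩⟩ | ⟨rfl, ⟨e⟩⟩)
    · exact isLyubeznik_of_iso_pathGraph_two e (by omega)
    · exact isLyubeznik_of_iso_pathGraph_three e
  intro hL
  obtain ⟨ord, h⟩ := hL.exists_tripleCondition
  have htri : ∀ a b c, G.Adj a b → G.Adj a c → G.Adj b c → False := by
    intro a b c hab hac hbc
    have hinj : Function.Injective ![a, b, c] := by
      intro i j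
      fin_cases i <;> fin_cases j <;>
        simp [hab.ne, hab.ne', hac.ne, hac.ne', hbc.ne, hbc.ne']
    obtain ⟨k, rfl⟩ := Nat.exists_eq_add_of_le' hn
    let φ : Fin 3 ↪ V := ⟨_, hinj⟩
    exact not_tripleCondition_of_triangle (H := G.comap φ) hab hac hbc k _ (h.comap φ)
  refine or_iff_not_imp_left.2 fun hK => ?_
  obtain ⟨c, x, y, hcx, hcy, hxy⟩ : ∃ c x y, G.Adj c x ∧ G.Adj c y ∧ x ≠ y := by
    obtain ⟨e, he⟩ := hedge
    induction e with | _ a b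
    have he : G.Adj a b := he
    obtain ⟨v, hv⟩ : ∃ v, v ∉ ({a, b} : Set V) := by
      by_contra! hall
      exact hK (nonempty_iso_pathGraph_two he fun v => by simpa using hall v)
    obtain ⟨u, hu, w, hw, huw⟩ := exists_adj_notMem hconn (u := a) (by simp) hv
    simp only [Set.mem_insert_iff, Set.mem_singleton_iff, not_or] at hu hw
    rcases hu with rfl | rfl
    · exact ⟨_, _, _, he, huw, Ne.symm hw.2⟩
    · exact ⟨_, _, _, he.symm, huw, Ne.symm hw.1⟩
  have hxy' : ¬ G.Adj x y := fun hadj => htri _ _ _ hcx hcy hadj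
  have hn2 : n = 2 := by
    by_contra hne
    obtain ⟨k, rfl⟩ := Nat.exists_eq_add_of_le' (show 3 ≤ n by omega)
    have hinj : Function.Injective ![c, x, y] := by
      intro i j
      fin_cases i <;> fin_cases j <;>
        simp [hcx.ne, hcx.ne', hcy.ne, hcy.ne', hxy, hxy.symm]
    let φ : Fin 3 ↪ V := ⟨_, hinj⟩
    exact not_tripleCondition_of_cherry (H := G.comap φ) hcx hcy hxy' k _ (h.comap φ)
  subst hn2
  have hpath : ∀ w x y z, G.Adj w x → G.Adj x y → G.Adj y z → w ≠ y → x ≠ z → w ≠ z →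
      False := by
    intro w x y z hwx hxy hyz hwy hxz hwz
    have hinj : Function.Injective ![w, x, y, z] := by
      intro i j
      fin_cases i <;> fin_cases j <;>
        simp [hwx.ne, hwx.ne', hxy.ne, hxy.ne', hyz.ne, hyz.ne', hwy, hwy.symm, hxz, hxz.symm,
          hwz, hwz.symm]
    let φ : Fin 4 ↪ V := ⟨_, hinj⟩
    exact not_tripleCondition_of_path (H := G.comap φ) hwx hxy hyz
      (fun hadj => htri _ _ _ hwx.symm hxy hadj) (fun hadj => htri _ _ _ hxy.symm hyz hadj) _
      (h.comap φ)
  refine ⟨rfl, nonempty_iso_pathGraph_three hcx.symm hcy hxy hxy' ?_⟩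
  by_contra! hall
  obtain ⟨v, hv⟩ := hall
  obtain ⟨u, hu, w, hw, huw⟩ := exists_adj_notMem hconn (S := {x, c, y}) (u := c) (v := v)
    (by simp) (by simpa using hv)
  simp only [Set.mem_insert_iff, Set.mem_singleton_iff, not_or] at hu hw
  obtain ⟨hwx, hwc, hwy⟩ := hw
  rcases hu with rfl | rfl | rfl
  · exact hpath _ _ _ _ huw.symm hcx.symm hcy hwc hxy hwy
  · have hinj : Function.Injective ![u, x, y, w] := by
      intro i j
      fin_cases i <;> fin_cases j <;>
        simp [hcx.ne, hcx.ne', hcy.ne, hcy.ne', huw.ne, huw.ne', hxy, hxy.symm, hwx, hwy,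
          Ne.symm hwx, Ne.symm hwy]
    let φ : Fin 4 ↪ V := ⟨_, hinj⟩
    exact not_tripleCondition_of_claw (H := G.comap φ) hcx hcy huw hxy'
      (fun hadj => htri _ _ _ hcx huw hadj) (fun hadj => htri _ _ _ hcy huw hadj) _ (h.comap φ)
  · exact hpath _ _ _ _ huw.symm hcy.symm hcx hwc hxy.symm hwx

end ChauHaMaithani
end
end

section
/- Let G be a finite connected chordal simple graph with at least one edge. The edge ideal I(G) is bridge-friendly if and only if G is isomorphic to BF(T,w) for some finite tree T and edge-weight function w : E(T) → ℕ. -/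
open scoped Classical

noncomputable section

namespace ChauHaMaithani

variable {V : Type*}

/-! ### Bridges and gaps of sets of edges -/

/-- `e` is a bridge of the set of edges `S`. -/
def EdgeBridge (S : Finset (Sym2 V)) (e : Sym2 V) : Prop :=
  e ∈ S ∧ ∀ v ∈ e, ∃ f ∈ S, f ≠ e ∧ v ∈ f

/-- `e` is a gap of the set of edges `S`. -/
def EdgeGap (S : Finset (Sym2 V)) (e : Sym2 V) : Prop :=
  e ∉ S ∧ ∀ v ∈ e, ∃ f ∈ S, v ∈ f

/-- `e` is a true gap of the set of edges `S`. -/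
def EdgeTrueGap (o : Sym2 V → ℕ) (S : Finset (Sym2 V)) (e : Sym2 V) : Prop :=
  EdgeGap S e ∧ ∀ f, EdgeBridge (insert e S) f → o f < o e → EdgeBridge S f

/-- `b` is the smallest bridge of `S`, and it dominates no true gap of `S` in `G`. -/
def EdgePot (G : SimpleGraph V) (o : Sym2 V → ℕ) (S : Finset (Sym2 V)) (b : Sym2 V) : Prop :=
  (EdgeBridge S b ∧ ∀ f, EdgeBridge S f → o b ≤ o f) ∧
    ∀ m ∈ G.edgeSet, EdgeTrueGap o S m → o b ≤ o m

/-- Two different potentially-type-2 sets of edges of `G` with the same matching partner,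
namely `τ ∪ {b}` and `τ ∪ {b'}`. -/
def EdgeConflict (G : SimpleGraph V) (o : Sym2 V → ℕ) : Prop :=
  ∃ (τ : Finset (Sym2 V)) (b b' : Sym2 V), (∀ e ∈ τ, e ∈ G.edgeSet) ∧ b ∈ G.edgeSet ∧
    b' ∈ G.edgeSet ∧ b ∉ τ ∧ b' ∉ τ ∧ b ≠ b' ∧
    EdgePot G o (insert b τ) b ∧ EdgePot G o (insert b' τ) b'

lemma edgeMon_injective : Function.Injective (edgeMon : Sym2 V → V → ℕ) := by
  intro e f h
  ext v
  have := congrFun h v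
  unfold edgeMon at this
  by_cases h1 : v ∈ e <;> by_cases h2 : v ∈ f <;> simp_all

/-- The set of edge monomials of a set of edges. -/
def edgeMons (S : Finset (Sym2 V)) : Finset (V → ℕ) := S.image edgeMon

lemma mem_edgeMons {S : Finset (Sym2 V)} {m : V → ℕ} :
    m ∈ edgeMons S ↔ ∃ e ∈ S, edgeMon e = m :=
  Finset.mem_image

lemma edgeMons_injective : Function.Injective (edgeMons : Finset (Sym2 V) → _) :=
  Finset.image_injective edgeMon_injective

lemma edgeMons_insert (S : Finset (Sym2 V)) (e : Sym2 V) :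
    insert (edgeMon e) (edgeMons S) = edgeMons (insert e S) :=
  (Finset.image_insert _ _ _).symm

lemma edgeMons_erase (S : Finset (Sym2 V)) (e : Sym2 V) :
    (edgeMons S).erase (edgeMon e) = edgeMons (S.erase e) :=
  (Finset.image_erase edgeMon_injective _ _).symm

lemma mlcm_edgeMons (S : Finset (Sym2 V)) (v : V) :
    mlcm (edgeMons S) v = if ∃ e ∈ S, v ∈ e then 1 else 0 := by
  unfold mlcm edgeMons
  split_ifs with h
  · obtain ⟨e, he, hv⟩ := h
    apply le_antisymm
    · apply Finset.sup_le
      simp only [Finset.mem_image]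
      rintro g ⟨f, -, rfl⟩
      unfold edgeMon
      split_ifs <;> omega
    · have h1 : edgeMon e v = 1 := by simp [edgeMon, hv]
      rw [← h1]
      exact Finset.le_sup (f := fun g : V → ℕ => g v) (Finset.mem_image_of_mem _ he)
  · apply Nat.le_zero.1
    apply Finset.sup_le
    simp only [Finset.mem_image]
    rintro g ⟨f, hf, rfl⟩
    have : v ∉ f := fun hv => h ⟨f, hf, hv⟩
    simp [edgeMon, this]

lemma mlcm_edgeMons_eq_iff (S S' : Finset (Sym2 V)) :
    mlcm (edgeMons S) = mlcm (edgeMons S') ↔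
      ∀ v, (∃ e ∈ S, v ∈ e) ↔ ∃ e ∈ S', v ∈ e := by
  rw [funext_iff]
  refine forall_congr' fun v => ?_
  rw [mlcm_edgeMons, mlcm_edgeMons]
  by_cases h : ∃ e ∈ S, v ∈ e <;> by_cases h' : ∃ e ∈ S', v ∈ e <;> simp only [h, h'] <;> simp

lemma edgeMon_mem_edgeMons (S : Finset (Sym2 V)) (e : Sym2 V) :
    edgeMon e ∈ edgeMons S ↔ e ∈ S :=
  edgeMon_injective.mem_finset_image

lemma isBridge_edgeMon (S : Finset (Sym2 V)) (e : Sym2 V) :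
    IsBridge (edgeMons S) (edgeMon e) ↔ EdgeBridge S e := by
  unfold IsBridge EdgeBridge
  rw [edgeMons_erase, mlcm_edgeMons_eq_iff, edgeMon_mem_edgeMons]
  refine and_congr_right fun he => ⟨fun h v hv => ?_, fun h v => ⟨?_, ?_⟩⟩
  · obtain ⟨f, hf, hvf⟩ := (h v).2 ⟨e, he, hv⟩
    rw [Finset.mem_erase] at hf
    exact ⟨f, hf.2, hf.1, hvf⟩
  · rintro ⟨f, hf, hvf⟩
    exact ⟨f, Finset.mem_of_mem_erase hf, hvf⟩
  · rintro ⟨f, hf, hvf⟩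
    by_cases hfe : f = e
    · subst hfe
      obtain ⟨g, hg, hge, hvg⟩ := h v hvf
      exact ⟨g, Finset.mem_erase.2 ⟨hge, hg⟩, hvg⟩
    · exact ⟨f, Finset.mem_erase.2 ⟨hfe, hf⟩, hvf⟩

lemma isGap_edgeMon (S : Finset (Sym2 V)) (e : Sym2 V) :
    IsGap (edgeMons S) (edgeMon e) ↔ EdgeGap S e := by
  unfold IsGap EdgeGap
  rw [edgeMons_insert, mlcm_edgeMons_eq_iff, edgeMon_mem_edgeMons]
  refine and_congr_right fun he => ⟨fun h v hv => ?_, fun h v => ⟨?_, ?_⟩⟩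
  · exact (h v).1 ⟨e, Finset.mem_insert_self _ _, hv⟩
  · rintro ⟨f, hf, hvf⟩
    rcases Finset.mem_insert.1 hf with rfl | hf
    · exact h v hvf
    · exact ⟨f, hf, hvf⟩
  · rintro ⟨f, hf, hvf⟩
    exact ⟨f, Finset.mem_insert_of_mem hf, hvf⟩

lemma exists_edge_of_isBridge {S : Finset (Sym2 V)} {m : V → ℕ}
    (h : IsBridge (edgeMons S) m) : ∃ e, m = edgeMon e := by
  obtain ⟨e, -, rfl⟩ := mem_edgeMons.1 h.1
  exact ⟨e, rfl⟩

lemma isTrueGap_edgeMon (ord : (V → ℕ) → ℕ) (S : Finset (Sym2 V)) (e : Sym2 V) :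
    IsTrueGap ord (edgeMons S) (edgeMon e) ↔ EdgeTrueGap (ord ∘ edgeMon) S e := by
  unfold IsTrueGap EdgeTrueGap
  rw [isGap_edgeMon, edgeMons_insert]
  refine and_congr_right fun _ => ⟨fun h f hf hlt => ?_, fun h m hm hlt => ?_⟩
  · exact (isBridge_edgeMon S f).1 (h _ ((isBridge_edgeMon _ f).2 hf) hlt)
  · obtain ⟨f, rfl⟩ := exists_edge_of_isBridge hm
    exact (isBridge_edgeMon S f).2 (h f ((isBridge_edgeMon _ f).1 hm) hlt)

lemma isSBridge_edgeMon (ord : (V → ℕ) → ℕ) (S : Finset (Sym2 V)) (b : Sym2 V) :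
    IsSBridge ord (edgeMons S) (edgeMon b) ↔
      EdgeBridge S b ∧ ∀ f, EdgeBridge S f → (ord ∘ edgeMon) b ≤ (ord ∘ edgeMon) f := by
  unfold IsSBridge
  rw [isBridge_edgeMon]
  refine and_congr_right fun _ => ⟨fun h f hf => ?_, fun h m hm => ?_⟩
  · exact h _ ((isBridge_edgeMon S f).2 hf)
  · obtain ⟨f, rfl⟩ := exists_edge_of_isBridge hm
    exact h f ((isBridge_edgeMon _ f).1 hm)

section Finite

variable [Fintype V]

lemma mem_edgeGens (G : SimpleGraph V) (m : V → ℕ) :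
    m ∈ edgeGens G ↔ ∃ e ∈ G.edgeSet, edgeMon e = m := by
  simp [edgeGens]

lemma edgePot_iff (G : SimpleGraph V) (ord : (V → ℕ) → ℕ) (S : Finset (Sym2 V)) (b : Sym2 V) :
    EdgePot G (ord ∘ edgeMon) S b ↔ PotType2 (edgeGens G) ord (edgeMons S) ∧
      IsSBridge ord (edgeMons S) (edgeMon b) := by
  unfold EdgePot
  rw [isSBridge_edgeMon, and_comm]
  refine and_congr_left fun hb => ⟨fun h => ?_, ?_⟩
  · refine ⟨edgeMon b, (isBridge_edgeMon S b).2 hb.1, fun m hm hg => ?_⟩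
    obtain ⟨e, he, rfl⟩ := (mem_edgeGens G m).1 hm
    exact not_lt.2 (h e he ((isTrueGap_edgeMon ord S e).1 hg))
  · rintro ⟨m, hm, h⟩ e he hg
    obtain ⟨c, rfl⟩ := exists_edge_of_isBridge hm
    refine (hb.2 c ((isBridge_edgeMon S c).1 hm)).trans ?_
    exact not_lt.1 (h _ ((mem_edgeGens G _).2 ⟨e, he, rfl⟩) ((isTrueGap_edgeMon ord S e).2 hg))

lemma exists_image_of_subset_edgeGens {G : SimpleGraph V} {σ : Finset (V → ℕ)}
    (h : σ ⊆ edgeGens G) : ∃ S : Finset (Sym2 V), (∀ e ∈ S, e ∈ G.edgeSet) ∧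
      edgeMons S = σ := by
  refine ⟨Finset.univ.filter fun e => edgeMon e ∈ σ, fun e he => ?_, ?_⟩
  · obtain ⟨f, hf, hfe⟩ := (mem_edgeGens G _).1 (h (Finset.mem_filter.1 he).2)
    rwa [← edgeMon_injective hfe]
  · ext m
    simp only [mem_edgeMons, Finset.mem_filter, Finset.mem_univ, true_and]
    constructor
    · rintro ⟨e, he, rfl⟩
      exact he
    · intro hm
      obtain ⟨f, -, rfl⟩ := (mem_edgeGens G _).1 (h hm)
      exact ⟨f, hm, rfl⟩

lemma not_edgeConflict_of_bridgeFriendlyWrt {G : SimpleGraph V} {ord : (V → ℕ) → ℕ}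
    (h : BridgeFriendlyWrt (edgeGens G) ord) : ¬ EdgeConflict G (ord ∘ edgeMon) := by
  rintro ⟨τ, b, b', hτ, hb, hb', hbτ, hbτ', hne, hp, hp'⟩
  have key : ∀ b b' : Sym2 V, b ∈ G.edgeSet → b' ∈ G.edgeSet → b ∉ τ → b' ∉ τ → b ≠ b' →
      EdgePot G (ord ∘ edgeMon) (insert b τ) b → EdgePot G (ord ∘ edgeMon) (insert b' τ) b' →
      ord (edgeMon b) < ord (edgeMon b') := by
    intro b b' hb hb' hbτ hbτ' hne hp hp'
    rw [edgePot_iff] at hp hp'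
    have hsub : ∀ c ∈ G.edgeSet, edgeMons (insert c τ) ⊆ edgeGens G := by
      intro c hc m hm
      obtain ⟨e, he, rfl⟩ := mem_edgeMons.1 hm
      refine (mem_edgeGens G _).2 ⟨e, ?_, rfl⟩
      rcases Finset.mem_insert.1 he with rfl | he
      exacts [hc, hτ e he]
    refine (h _ (hsub b hb) hp.1).2 _ (hsub b' hb') (fun heq => ?_) hp'.1 _ _ hp.2 hp'.2 ?_
    · have := edgeMons_injective heq
      have hmem : b' ∈ insert b τ := by rw [← this]; exact Finset.mem_insert_self _ _
      rcases Finset.mem_insert.1 hmem with h1 | h1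
      exacts [hne h1.symm, hbτ' h1]
    · rw [edgeMons_erase, edgeMons_erase,
        Finset.erase_insert hbτ, Finset.erase_insert hbτ']
  exact lt_asymm (key b b' hb hb' hbτ hbτ' hne hp hp') (key b' b hb' hb hbτ' hbτ hne.symm hp' hp)

lemma bridgeFriendlyWrt_of_not_edgeConflict {G : SimpleGraph V} {ord : (V → ℕ) → ℕ}
    (h : ¬ EdgeConflict G (ord ∘ edgeMon)) : BridgeFriendlyWrt (edgeGens G) ord := by
  intro σ hσ hpot
  refine ⟨hpot, fun σ' hσ' hne hpot' m m' hm hm' herase => (h ?_).elim⟩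
  obtain ⟨S, hS, rfl⟩ := exists_image_of_subset_edgeGens hσ
  obtain ⟨S', hS', rfl⟩ := exists_image_of_subset_edgeGens hσ'
  obtain ⟨b, rfl⟩ := exists_edge_of_isBridge hm.1
  obtain ⟨b', rfl⟩ := exists_edge_of_isBridge hm'.1
  have hb := (edgePot_iff G ord S b).2 ⟨hpot, hm⟩
  have hb' := (edgePot_iff G ord S' b').2 ⟨hpot', hm'⟩
  rw [edgeMons_erase, edgeMons_erase] at herase
  have herase := edgeMons_injective herase
  have e1 : insert b (S.erase b) = S := Finset.insert_erase hb.1.1.1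
  have e2 : insert b' (S.erase b) = S' := by rw [← herase]; exact Finset.insert_erase hb'.1.1.1
  refine ⟨S.erase b, b, b', fun e he => hS e (Finset.mem_of_mem_erase he), hS b hb.1.1.1,
    hS' b' hb'.1.1.1, Finset.notMem_erase _ _, ?_, ?_, ?_, ?_⟩
  · rw [← herase]; exact Finset.notMem_erase _ _
  · rintro rfl
    exact hne (congrArg _ (e2.symm.trans e1))
  · rwa [e1]
  · rwa [e2]

end Finite

/-! ### A sufficient condition for bridge-friendliness -/

lemma EdgeGap.exists_of_not_edgeTrueGap {o : Sym2 V → ℕ} {S : Finset (Sym2 V)} {e : Sym2 V}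
    (hg : EdgeGap S e) (hn : ¬ EdgeTrueGap o S e) :
    ∃ f ∈ S, EdgeBridge (insert e S) f ∧ o f < o e ∧ ∃ z ∈ f, z ∈ e ∧ ∀ g ∈ S, z ∈ g → g = f := by
  have h : ∃ f, EdgeBridge (insert e S) f ∧ o f < o e ∧ ¬ EdgeBridge S f := by
    by_contra! hcon
    exact hn ⟨hg, hcon⟩
  obtain ⟨f, hf, hlt, hfS⟩ := h
  have hfmem : f ∈ S := (Finset.mem_insert.1 hf.1).resolve_left fun h => hlt.ne (by rw [h])
  have hz : ∃ z ∈ f, ∀ g ∈ S, z ∈ g → g = f := by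
    by_contra! hcon
    refine hfS ⟨hfmem, fun v hv => ?_⟩
    obtain ⟨g, hg, hvg, hgf⟩ := hcon v hv
    exact ⟨g, hg, hgf, hvg⟩
  obtain ⟨z, hzf, hz⟩ := hz
  refine ⟨f, hfmem, hf, hlt, z, hzf, ?_, hz⟩
  obtain ⟨g, hg, hgf, hzg⟩ := hf.2 z hzf
  rcases Finset.mem_insert.1 hg with rfl | hg
  · exact hzg
  · exact (hgf (hz g hg hzg)).elim

/-- The local shape of a conflict: a walk `u - x - y - v` whose middle edge is smaller than the
other two. -/
structure ConflictPath (G : SimpleGraph V) (o : Sym2 V → ℕ) (τ : Finset (Sym2 V))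
    (u x y v : V) : Prop where
  sub : ∀ e ∈ τ, e ∈ G.edgeSet
  mem : s(x, y) ∈ τ
  left : ∀ e ∈ τ, x ∈ e → e = s(x, y)
  right : ∀ e ∈ τ, y ∈ e → e = s(x, y)
  adj_left : G.Adj u x
  adj_right : G.Adj y v
  ne_left : u ≠ y
  ne_right : v ≠ x
  cov_left : ∃ e ∈ τ, u ∈ e
  cov_right : ∃ e ∈ τ, v ∈ e
  lt_left : o s(x, y) < o s(u, x)
  lt_right : o s(x, y) < o s(y, v)
  gap_left : ∀ m ∈ G.edgeSet, EdgeTrueGap o (insert s(u, x) τ) m → o s(u, x) ≤ o m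
  gap_right : ∀ m ∈ G.edgeSet, EdgeTrueGap o (insert s(y, v) τ) m → o s(y, v) ≤ o m

lemma ConflictPath.symm {G : SimpleGraph V} {o : Sym2 V → ℕ} {τ : Finset (Sym2 V)} {u x y v : V}
    (h : ConflictPath G o τ u x y v) : ConflictPath G o τ v y x u where
  sub := h.sub
  mem := Sym2.eq_swap (a := x) (b := y) ▸ h.mem
  left := Sym2.eq_swap (a := x) (b := y) ▸ h.right
  right := Sym2.eq_swap (a := x) (b := y) ▸ h.left
  adj_left := h.adj_right.symm
  adj_right := h.adj_left.symm
  ne_left := h.ne_right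
  ne_right := h.ne_left
  cov_left := h.cov_right
  cov_right := h.cov_left
  lt_left := by rw [Sym2.eq_swap (a := y), Sym2.eq_swap (a := v)]; exact h.lt_right
  lt_right := by
    rw [Sym2.eq_swap (a := y) (b := x), Sym2.eq_swap (a := x) (b := u)]; exact h.lt_left
  gap_left := by rw [Sym2.eq_swap (a := v)]; exact h.gap_right
  gap_right := by rw [Sym2.eq_swap (a := x)]; exact h.gap_left

lemma EdgeBridge.of_insert {S : Finset (Sym2 V)} {b : Sym2 V}
    (h : EdgeBridge (insert b S) b) {v : V} (hv : v ∈ b) : ∃ e ∈ S, v ∈ e := by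
  obtain ⟨f, hf, hfb, hvf⟩ := h.2 v hv
  exact ⟨f, (Finset.mem_insert.1 hf).resolve_left hfb, hvf⟩

lemma EdgeConflict.exists_conflictPath {G : SimpleGraph V} {o : Sym2 V → ℕ}
    (hinj : Set.InjOn o G.edgeSet) (h : EdgeConflict G o) :
    ∃ τ u x y v, ConflictPath G o τ u x y v := by
  obtain ⟨τ, b, b', hτ, hb, hb', hbτ, hbτ', hne, hp, hp'⟩ := h
  wlog hlt : o b < o b' generalizing b b'
  · refine this b' b hb' hb hbτ' hbτ hne.symm hp' hp ?_
    exact lt_of_le_of_ne (not_lt.1 hlt) fun h => hne (hinj hb hb' h.symm)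
  have hgap : EdgeGap (insert b' τ) b := by
    refine ⟨by simp [hne, hbτ], fun v hv => ?_⟩
    obtain ⟨e, he, hve⟩ := hp.1.1.of_insert hv
    exact ⟨e, Finset.mem_insert_of_mem he, hve⟩
  obtain ⟨m, hmS, hmb, hmlt, x, hxm, hxb, hx⟩ :=
    hgap.exists_of_not_edgeTrueGap fun h => (hp'.2 b hb h).not_gt hlt
  have hmτ : m ∈ τ := (Finset.mem_insert.1 hmS).resolve_left fun h => (hmlt.trans hlt).ne (by rw [h])
  have hm : ¬ EdgeBridge (insert b τ) m := fun h => (hp.1.2 m h).not_gt hmlt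
  have hy : ∃ y ∈ m, ∀ g ∈ insert b τ, y ∈ g → g = m := by
    by_contra! hcon
    refine hm ⟨Finset.mem_insert_of_mem hmτ, fun v hv => ?_⟩
    obtain ⟨g, hg, hvg, hgf⟩ := hcon v hv
    exact ⟨g, hg, hgf, hvg⟩
  obtain ⟨y, hym, hy⟩ := hy
  have hyb' : y ∈ b' := by
    obtain ⟨g, hg, hgm, hyg⟩ := hmb.2 y hym
    rw [Finset.mem_insert, Finset.mem_insert] at hg
    rcases hg with rfl | rfl | hg
    · exact (hgm (hy _ (Finset.mem_insert_self _ _) hyg)).elim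
    · exact hyg
    · exact (hgm (hy _ (Finset.mem_insert_of_mem hg) hyg)).elim
  have hbm : b ≠ m := fun h => hmlt.ne (by rw [h])
  have hbm' : b' ≠ m := fun h => (hmlt.trans hlt).ne (by rw [h])
  have hyb : y ∉ b := fun h => hbm (hy b (Finset.mem_insert_self _ _) h)
  have hxb' : x ∉ b' := fun h => hbm' (hx b' (Finset.mem_insert_self _ _) h)
  have hxy : x ≠ y := fun h => hyb (h ▸ hxb)
  obtain rfl : m = s(x, y) := (Sym2.mem_and_mem_iff hxy).1 ⟨hxm, hym⟩
  obtain ⟨u, rfl⟩ := Sym2.mem_iff_exists.1 hxb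
  obtain ⟨v, rfl⟩ := Sym2.mem_iff_exists.1 hyb'
  refine ⟨τ, u, x, y, v, hτ, hmτ, fun e he hxe => hx e (Finset.mem_insert_of_mem he) hxe,
    fun e he hye => hy e (Finset.mem_insert_of_mem he) hye, SimpleGraph.Adj.symm hb, hb', ?_, ?_,
    hp.1.1.of_insert (by simp), hp'.1.1.of_insert (by simp), ?_, hmlt.trans hlt, ?_, hp'.2⟩
  · rintro rfl
    exact hyb (by simp)
  · rintro rfl
    exact hxb' (by simp)
  · rwa [Sym2.eq_swap (a := u)]
  · rw [Sym2.eq_swap (a := u)]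
    exact hp.2

/-- The triangle tips of `G` are the elements of `D`, the remaining vertices span a graph for which
no edge is smaller than an edge at each of its ends, and edges at a triangle tip are larger than
the others. -/
structure TipOrder (G : SimpleGraph V) (D : Set V) (o : Sym2 V → ℕ) : Prop where
  nbr : ∀ d ∈ D, ∃ a b, a ∉ D ∧ b ∉ D ∧ G.Adj a b ∧ ∀ v, G.Adj d v ↔ v = a ∨ v = b
  lt_tip : ∀ x y d z, x ∉ D → y ∉ D → d ∈ D → G.Adj x y → G.Adj d z → o s(x, y) < o s(d, z)
  lt_of_adj : ∀ x y, x ∉ D → y ∉ D → G.Adj x y →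
    (∀ u, u ∉ D → G.Adj x u → u ≠ y → o s(x, u) < o s(x, y)) ∨
    (∀ v, v ∉ D → G.Adj y v → v ≠ x → o s(y, v) < o s(x, y))

lemma TipOrder.eq_or_eq {G : SimpleGraph V} {D : Set V} {o : Sym2 V → ℕ} (h : TipOrder G D o)
    {d x y : V} (hd : d ∈ D) (hx : G.Adj d x) (hy : G.Adj d y) (hxy : x ≠ y) :
    x ∉ D ∧ y ∉ D ∧ G.Adj x y ∧ ∀ z, G.Adj d z → z = x ∨ z = y := by
  obtain ⟨a, b, ha, hb, hab, hN⟩ := h.nbr d hd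
  rcases (hN x).1 hx with rfl | rfl <;> rcases (hN y).1 hy with rfl | rfl
  · exact (hxy rfl).elim
  · exact ⟨ha, hb, hab, fun z hz => (hN z).1 hz⟩
  · exact ⟨hb, ha, hab.symm, fun z hz => ((hN z).1 hz).symm⟩
  · exact (hxy rfl).elim

lemma TipOrder.notMem_of_conflictPath {G : SimpleGraph V} {D : Set V} {o : Sym2 V → ℕ}
    (h : TipOrder G D o) {τ : Finset (Sym2 V)} {u x y v : V} (hc : ConflictPath G o τ u x y v) :
    x ∉ D := by
  intro hx
  have hxy : G.Adj x y := hc.sub _ hc.mem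
  obtain ⟨hu, hy, huy, -⟩ := h.eq_or_eq hx hc.adj_left.symm hxy hc.ne_left
  have hux : u ≠ x := hc.adj_left.ne
  have hyx : y ≠ x := hxy.ne'
  have hlt : o s(u, y) < o s(u, x) := by
    rw [Sym2.eq_swap (a := u) (b := x)]
    exact h.lt_tip u y x u hu hy hx huy hc.adj_left.symm
  have hlt' : o s(u, y) < o s(x, y) := h.lt_tip u y x y hu hy hx huy hxy
  have hgap : EdgeGap (insert s(u, x) τ) s(u, y) := by
    constructor
    · rw [Finset.mem_insert]
      rintro (h1 | h1)
      · rw [h1] at hlt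
        exact hlt.ne rfl
      · rw [hc.right _ h1 (by simp)] at hlt'
        exact hlt'.ne rfl
    · intro z hz
      rcases Sym2.mem_iff.1 hz with rfl | rfl
      · exact ⟨s(z, x), by simp, by simp⟩
      · exact ⟨s(x, z), by simp [hc.mem], by simp⟩
  obtain ⟨f, hf, -, hflt, z, hzf, hz, hzS⟩ :=
    hgap.exists_of_not_edgeTrueGap fun ht => (hc.gap_left _ huy ht).not_gt hlt
  rcases Sym2.mem_iff.1 hz with rfl | rfl
  · rw [← hzS s(z, x) (by simp) (by simp)] at hflt
    exact hflt.not_gt hlt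
  · rw [← hzS s(x, z) (by simp [hc.mem]) (by simp)] at hflt
    exact hflt.not_gt hlt'

lemma TipOrder.not_forall_lt {G : SimpleGraph V} {D : Set V} {o : Sym2 V → ℕ}
    (h : TipOrder G D o) {τ : Finset (Sym2 V)} {u x y v : V} (hc : ConflictPath G o τ u x y v)
    (hlt : ∀ u, u ∉ D → G.Adj x u → u ≠ y → o s(x, u) < o s(x, y)) : False := by
  have hxy : G.Adj x y := hc.sub _ hc.mem
  have hx := h.notMem_of_conflictPath hc
  have hu : u ∈ D := by
    by_contra hu
    have := hlt u hu hc.adj_left.symm hc.ne_left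
    rw [Sym2.eq_swap (a := x)] at this
    exact this.not_gt hc.lt_left
  obtain ⟨e, he, hue⟩ := hc.cov_left
  obtain ⟨w, rfl⟩ := Sym2.mem_iff_exists.1 hue
  have huw : G.Adj u w := hc.sub _ he
  have hux : u ≠ x := hc.adj_left.ne
  have hnot : s(u, w) ≠ s(x, y) := by
    intro h1
    rcases Sym2.mem_iff.1 (h1 ▸ hue) with h2 | h2
    exacts [hux h2, hc.ne_left h2]
  have hwx : w ≠ x := fun h1 => hnot (hc.left _ he (by simp [h1]))
  have hwy : w ≠ y := fun h1 => hnot (hc.right _ he (by simp [h1]))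
  obtain ⟨-, hw, hxw, -⟩ := h.eq_or_eq hu hc.adj_left huw hwx.symm
  have hlt1 : o s(x, w) < o s(x, y) := hlt w hw hxw hwy
  have hlt2 : o s(x, w) < o s(u, x) := h.lt_tip x w u x hx hw hu hxw hc.adj_left
  have hlt3 : o s(x, w) < o s(u, w) := h.lt_tip x w u w hx hw hu hxw huw
  have hgap : EdgeGap (insert s(u, x) τ) s(x, w) := by
    constructor
    · rw [Finset.mem_insert]
      rintro (h1 | h1)
      · rw [h1] at hlt2
        exact hlt2.ne rfl
      · rw [hc.left _ h1 (by simp)] at hlt1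
        exact hlt1.ne rfl
    · intro z hz
      rcases Sym2.mem_iff.1 hz with rfl | rfl
      · exact ⟨s(u, z), by simp, by simp⟩
      · exact ⟨s(u, z), by simp [he], by simp⟩
  obtain ⟨f, hf, -, hflt, z, hzf, hz, hzS⟩ :=
    hgap.exists_of_not_edgeTrueGap fun ht => (hc.gap_left _ hxw ht).not_gt hlt2
  rcases Sym2.mem_iff.1 hz with rfl | rfl
  · rw [← hzS s(u, z) (by simp) (by simp)] at hflt
    exact hflt.not_gt hlt2
  · rw [← hzS s(u, z) (by simp [he]) (by simp)] at hflt
    exact hflt.not_gt hlt3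

lemma TipOrder.not_edgeConflict {G : SimpleGraph V} {D : Set V} {o : Sym2 V → ℕ}
    (h : TipOrder G D o) (hinj : Set.InjOn o G.edgeSet) : ¬ EdgeConflict G o := by
  intro hcon
  obtain ⟨τ, u, x, y, v, hc⟩ := hcon.exists_conflictPath hinj
  rcases h.lt_of_adj x y (h.notMem_of_conflictPath hc) (h.notMem_of_conflictPath hc.symm)
    (hc.sub _ hc.mem) with h1 | h1
  · exact h.not_forall_lt hc h1
  · refine h.not_forall_lt hc.symm fun w hw hyw hwx => ?_
    rw [Sym2.eq_swap (a := y) (b := x)]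
    exact h1 w hw hyw hwx

lemma TipOrder.bridgeFriendly [Fintype V] {G : SimpleGraph V} {D : Set V} {o : Sym2 V → ℕ}
    (h : TipOrder G D o) (hinj : Set.InjOn o G.edgeSet) (hne : G.edgeSet.Nonempty) :
    BridgeFriendly (edgeGens G) := by
  have : Nonempty (Sym2 V) := ⟨hne.some⟩
  have hcomp : (o ∘ Function.invFun edgeMon) ∘ edgeMon = o := by
    rw [Function.comp_assoc, Function.invFun_comp edgeMon_injective, Function.comp_id]
  refine ⟨o ∘ Function.invFun edgeMon, ?_, ?_⟩
  · intro m hm m' hm' heq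
    obtain ⟨e, he, rfl⟩ := (mem_edgeGens G _).1 hm
    obtain ⟨e', he', rfl⟩ := (mem_edgeGens G _).1 hm'
    rw [hinj he he' ((congrFun hcomp e).symm.trans (heq.trans (congrFun hcomp e')))]
  · apply bridgeFriendlyWrt_of_not_edgeConflict
    rw [hcomp]
    exact h.not_edgeConflict hinj

/-! ### The graphs `BF(T, w)` are bridge-friendly -/

section BFGraph

variable {VT : Type} {T : SimpleGraph VT} {w : T.edgeSet → ℕ}

lemma bfGraph_adj_inl_inl (a b : VT) :
    (BFGraph T w).Adj (Sum.inl a) (Sum.inl b) ↔ T.Adj a b := by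
  simp only [BFGraph, SimpleGraph.fromRel_adj]
  constructor
  · rintro ⟨-, h⟩
    simp only [Sum.inl.injEq, reduceCtorEq, false_and, and_false, exists_false, or_false] at h
    rcases h with ⟨_, _, rfl, rfl, h⟩ | ⟨_, _, rfl, rfl, h⟩
    exacts [h, h.symm]
  · intro h
    exact ⟨fun heq => h.ne (Sum.inl_injective heq), Or.inl (Or.inl ⟨a, b, rfl, rfl, h⟩)⟩

lemma bfGraph_adj_inr_inl (p : Σ e : T.edgeSet, Fin (w e)) (a : VT) :
    (BFGraph T w).Adj (Sum.inr p) (Sum.inl a) ↔ a ∈ (p.1 : Sym2 VT) := by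
  simp only [BFGraph, SimpleGraph.fromRel_adj]
  constructor
  · rintro ⟨-, h⟩
    simp only [Sum.inl.injEq, Sum.inr.injEq, reduceCtorEq, false_and, and_false, exists_false,
      or_false, false_or] at h
    obtain ⟨_, _, _, rfl, rfl, h⟩ := h
    exact h
  · intro h
    exact ⟨Sum.inr_ne_inl, Or.inr (Or.inr ⟨a, p.1, p.2, rfl, rfl, h⟩)⟩

lemma not_bfGraph_adj_inr_inr (p q : Σ e : T.edgeSet, Fin (w e)) :
    ¬ (BFGraph T w).Adj (Sum.inr p) (Sum.inr q) := by
  simp [BFGraph, SimpleGraph.fromRel_adj]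

lemma eq_of_dist_eq_add_one (hT : T.IsTree) {r a b c : VT} (hb : T.Adj b a)
    (hc : T.Adj c a) (hdb : T.dist r a = T.dist r b + 1) (hdc : T.dist r a = T.dist r c + 1) :
    b = c := by
  obtain ⟨p, hp⟩ := (hT.connected r b).exists_walk_length_eq_dist
  obtain ⟨q, hq⟩ := (hT.connected r c).exists_walk_length_eq_dist
  have hp' : (p.concat hb).IsPath := by
    apply SimpleGraph.Walk.isPath_of_length_eq_dist
    rw [SimpleGraph.Walk.length_concat, hp, hdb]
  have hq' : (q.concat hc).IsPath := by
    apply SimpleGraph.Walk.isPath_of_length_eq_dist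
    rw [SimpleGraph.Walk.length_concat, hq, hdc]
  have h := congrArg Subtype.val ((hT.isAcyclic.subsingleton_path r a).elim ⟨_, hp'⟩ ⟨_, hq'⟩)
  simpa using congrArg SimpleGraph.Walk.penultimate h

lemma dist_lt_or_dist_lt (hT : T.IsTree) (r : VT) {a b : VT} (hab : T.Adj a b) :
    (∀ c, T.Adj a c → c ≠ b → T.dist r b < T.dist r c) ∨
      (∀ c, T.Adj b c → c ≠ a → T.dist r a < T.dist r c) := by
  rcases hT.dist_eq_dist_add_one_of_adj r hab with h | h
  · refine Or.inl fun c hac hcb => ?_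
    rcases hT.dist_eq_dist_add_one_of_adj r hac with h' | h'
    · exact (hcb (eq_of_dist_eq_add_one hT hac.symm hab.symm h' h)).elim
    · omega
  · refine Or.inr fun c hbc hca => ?_
    rcases hT.dist_eq_dist_add_one_of_adj r hbc with h' | h'
    · exact (hca (eq_of_dist_eq_add_one hT hbc.symm hab h' h)).elim
    · omega

end BFGraph

/-- Any function on a finite type is refined by an injective one. -/
lemma exists_injective_lt_of_lt {α : Type*} [Fintype α] (key : α → ℕ) :
    ∃ o : α → ℕ, Function.Injective o ∧ ∀ a b, key a < key b → o a < o b := by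
  set K := Fintype.card α
  have hlt : ∀ a b, key a < key b →
      key a * K + (Fintype.equivFin α a : ℕ) < key b * K + (Fintype.equivFin α b : ℕ) := by
    intro a b h
    have h1 : (key a + 1) * K ≤ key b * K := Nat.mul_le_mul_right _ h
    have h2 := (Fintype.equivFin α a).2
    rw [Nat.add_mul, one_mul] at h1
    omega
  refine ⟨fun a => key a * K + (Fintype.equivFin α a : ℕ), fun a b h => ?_, hlt⟩
  rcases lt_trichotomy (key a) (key b) with h1 | h1 | h1
  · exact ((hlt a b h1).ne h).elim
  · simp only [h1, Nat.add_left_cancel_iff] at h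
    exact (Fintype.equivFin α).injective (Fin.ext h)
  · exact ((hlt b a h1).ne h.symm).elim

lemma exists_tipOrder {V : Type} [Fintype V] {G : SimpleGraph V} {VT : Type}
    {T : SimpleGraph VT} (hT : T.IsTree) {w : T.edgeSet → ℕ} (φ : G ≃g BFGraph T w) :
    ∃ (D : Set V) (o : Sym2 V → ℕ), Function.Injective o ∧ TipOrder G D o := by
  obtain ⟨r⟩ := hT.connected.nonempty
  let D : Set V := {v | (φ v).isRight}
  let h : V → ℕ := fun v => Sum.elim (T.dist r) (fun _ => 0) (φ v)
  let M : ℕ := Finset.univ.sup h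
  have hM : ∀ v, h v ≤ M := fun v => Finset.le_sup (Finset.mem_univ v)
  let key : Sym2 V → ℕ := fun e => if ∃ d ∈ D, d ∈ e then 2 * M + 1 else
    2 * M - Sym2.lift ⟨fun a b => h a + h b, fun a b => add_comm _ _⟩ e
  have hkey_tip : ∀ d z, d ∈ D → key s(d, z) = 2 * M + 1 := fun d z hd =>
    if_pos ⟨d, hd, Sym2.mem_mk_left d z⟩
  have hkey : ∀ x y, x ∉ D → y ∉ D → key s(x, y) = 2 * M - (h x + h y) := by
    intro x y hx hy
    apply if_neg
    rintro ⟨d, hd, hmem⟩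
    rcases Sym2.mem_iff.1 hmem with rfl | rfl
    exacts [hx hd, hy hd]
  have hinl : ∀ v, v ∉ D → ∃ a, φ v = Sum.inl a := by
    intro v hv
    rcases hφ : φ v with a | p
    · exact ⟨a, rfl⟩
    · exact (hv (by simp [D, hφ])).elim
  obtain ⟨o, hinj, ho⟩ := exists_injective_lt_of_lt key
  refine ⟨D, o, hinj, ?_, ?_, ?_⟩
  · intro d hd
    obtain ⟨p, hp⟩ := Sum.isRight_iff.1 hd
    obtain ⟨⟨e, he⟩, i⟩ := p
    induction e using Sym2.ind with
    | _ a b =>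
    have hnotD : ∀ c, φ.symm (Sum.inl c) ∉ D := fun c => by simp [D]
    refine ⟨φ.symm (Sum.inl a), φ.symm (Sum.inl b), hnotD a, hnotD b, ?_, fun v => ?_⟩
    · rw [φ.symm.map_adj_iff, bfGraph_adj_inl_inl]
      exact he
    · rw [← φ.map_adj_iff, hp]
      have hv : ∀ c, v = φ.symm (Sum.inl c) ↔ φ v = Sum.inl c := fun c => by
        rw [φ.eq_symm_apply]
      rw [hv, hv]
      rcases φ v with c | q
      · rw [bfGraph_adj_inr_inl]
        simp
      · simp [not_bfGraph_adj_inr_inr]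
  · intro x y d z hx hy hd _ _
    apply ho
    rw [hkey x y hx hy, hkey_tip d z hd]
    omega
  · intro x y hx hy hxy
    obtain ⟨a, ha⟩ := hinl x hx
    obtain ⟨b, hb⟩ := hinl y hy
    have hab : T.Adj a b := by
      rw [← bfGraph_adj_inl_inl (w := w), ← ha, ← hb, φ.map_adj_iff]
      exact hxy
    have main : ∀ x y u, x ∉ D → y ∉ D → u ∉ D → h y < h u → o s(x, u) < o s(x, y) := by
      intro x y u hx hy hu hlt
      apply ho
      rw [hkey x u hx hu, hkey x y hx hy]
      have := hM x
      have := hM u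
      omega
    have hval : ∀ v c, φ v = Sum.inl c → h v = T.dist r c := fun v c hv => by simp [h, hv]
    have hstep : ∀ x y a b, x ∉ D → y ∉ D → φ x = Sum.inl a → φ y = Sum.inl b →
        (∀ c, T.Adj a c → c ≠ b → T.dist r b < T.dist r c) →
        ∀ u, u ∉ D → G.Adj x u → u ≠ y → o s(x, u) < o s(x, y) := by
      intro x y a b hx hy ha hb hlt u hu hxu huy
      obtain ⟨c, hc⟩ := hinl u hu
      apply main x y u hx hy hu
      rw [hval _ _ hb, hval _ _ hc]
      apply hlt
      · rw [← bfGraph_adj_inl_inl (w := w), ← ha, ← hc, φ.map_adj_iff]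
        exact hxu
      · rintro rfl
        exact huy (φ.injective (hc.trans hb.symm))
    rcases dist_lt_or_dist_lt hT r hab with h1 | h1
    · exact Or.inl (hstep x y a b hx hy ha hb h1)
    · rw [Sym2.eq_swap (a := x) (b := y)]
      exact Or.inr (hstep y x b a hy hx hb ha h1)

/-! ### Forbidden configurations around a triangle -/

lemma edgePot_path {G : SimpleGraph V} {o : Sym2 V → ℕ} {y x u w : V}
    (hxu : G.Adj x u) (hxy' : x ≠ y) (huw' : u ≠ w) (hyu : y ≠ u) (hxw : x ≠ w) (hyw : y ≠ w)
    (h : o s(x, y) < o s(x, u)) (h1 : G.Adj y u → o s(x, y) < o s(y, u))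
    (h2 : G.Adj y w → o s(x, y) < o s(y, w) ∨ o s(u, w) < o s(y, w))
    (h3 : G.Adj x w → o s(u, w) < o s(x, w) ∨ o s(x, u) < o s(x, w)) :
    EdgePot G o (insert s(x, u) {s(x, y), s(u, w)}) s(x, u) := by
  have hxu' := hxu.ne
  set S : Finset (Sym2 V) := insert s(x, u) {s(x, y), s(u, w)} with hS
  have hxyS : ¬ EdgeBridge S s(x, y) := by
    intro hb
    obtain ⟨f, hf, hne, hyf⟩ := hb.2 y (by simp)
    simp only [hS, Finset.mem_insert, Finset.mem_singleton] at hf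
    rcases hf with rfl | rfl | rfl
    · rcases Sym2.mem_iff.1 hyf with h | h
      exacts [hxy' h.symm, hyu h]
    · exact hne rfl
    · rcases Sym2.mem_iff.1 hyf with h | h
      exacts [hyu h, hyw h]
  have huwS : ¬ EdgeBridge S s(u, w) := by
    intro hb
    obtain ⟨f, hf, hne, hwf⟩ := hb.2 w (by simp)
    simp only [hS, Finset.mem_insert, Finset.mem_singleton] at hf
    rcases hf with rfl | rfl | rfl
    · rcases Sym2.mem_iff.1 hwf with h | h
      exacts [hxw h.symm, huw' h.symm]
    · rcases Sym2.mem_iff.1 hwf with h | h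
      exacts [hxw h.symm, hyw h.symm]
    · exact hne rfl
  have hxyS' : s(x, y) ∈ S := by simp [hS]
  have huwS' : s(u, w) ∈ S := by simp [hS]
  have hxuS' : s(x, u) ∈ S := by simp [hS]
  refine ⟨⟨⟨hxuS', fun v hv => ?_⟩, fun f hf => ?_⟩, fun m hm hg => ?_⟩
  · rcases Sym2.mem_iff.1 hv with rfl | rfl
    · refine ⟨_, hxyS', fun heq => ?_, by simp⟩
      exact hyu (Sym2.congr_right.1 heq)
    · refine ⟨_, huwS', fun heq => ?_, by simp⟩
      rw [Sym2.eq_swap (a := x)] at heq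
      exact hxw (Sym2.congr_right.1 heq).symm
  · have hf' := hf.1
    simp only [hS, Finset.mem_insert, Finset.mem_singleton] at hf'
    rcases hf' with rfl | rfl | rfl
    exacts [le_rfl, (hxyS hf).elim, (huwS hf).elim]
  · by_contra! hlt
    have hxy_bridge : y ∈ m → (∀ z ∈ s(x, y), ∃ f ∈ insert m S, f ≠ s(x, y) ∧ z ∈ f) →
        ¬ o s(x, y) < o m := fun _ hz hlt' =>
      hxyS (hg.2 _ ⟨Finset.mem_insert_of_mem hxyS', hz⟩ hlt')
    have huw_bridge : w ∈ m → (∀ z ∈ s(u, w), ∃ f ∈ insert m S, f ≠ s(u, w) ∧ z ∈ f) →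
        ¬ o s(u, w) < o m := fun _ hz hlt' =>
      huwS (hg.2 _ ⟨Finset.mem_insert_of_mem huwS', hz⟩ hlt')
    have hxy_lt : y ∈ m → ¬ o s(x, y) < o m := by
      intro hy
      apply hxy_bridge hy
      intro z hz
      rcases Sym2.mem_iff.1 hz with rfl | rfl
      · refine ⟨_, Finset.mem_insert_of_mem hxuS', fun heq => ?_, by simp⟩
        exact hyu (Sym2.congr_right.1 heq).symm
      · refine ⟨m, Finset.mem_insert_self _ _, fun heq => ?_, hy⟩
        exact hg.1.1 (heq ▸ hxyS')
    have huw_lt : w ∈ m → ¬ o s(u, w) < o m := by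
      intro hw
      apply huw_bridge hw
      intro z hz
      rcases Sym2.mem_iff.1 hz with rfl | rfl
      · refine ⟨_, Finset.mem_insert_of_mem hxuS', fun heq => ?_, by simp⟩
        rw [Sym2.eq_swap (a := x)] at heq
        exact hxw (Sym2.congr_right.1 heq)
      · refine ⟨m, Finset.mem_insert_self _ _, fun heq => ?_, hw⟩
        exact hg.1.1 (heq ▸ huwS')
    have hvert : ∀ z ∈ m, z = x ∨ z = y ∨ z = u ∨ z = w := by
      intro z hz
      obtain ⟨f, hf, hzf⟩ := hg.1.2 z hz
      simp only [hS, Finset.mem_insert, Finset.mem_singleton] at hf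
      rcases hf with rfl | rfl | rfl <;> rcases Sym2.mem_iff.1 hzf with rfl | rfl <;> simp
    have hmS := hg.1.1
    have key : ∀ a b, m = s(a, b) → (a = x ∧ b = w) ∨ (a = y ∧ b = u) ∨ (a = y ∧ b = w) →
        False := by
      rintro a b rfl (⟨rfl, rfl⟩ | ⟨rfl, rfl⟩ | ⟨rfl, rfl⟩)
      · rcases h3 hm with h3 | h3
        · exact huw_lt (by simp) h3
        · exact h3.not_gt hlt
      · exact hxy_lt (by simp) (h1 hm)
      · rcases h2 hm with h2 | h2
        · exact hxy_lt (by simp) h2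
        · exact huw_lt (by simp) h2
    induction m using Sym2.ind with
    | _ a b =>
    have hne : a ≠ b := SimpleGraph.Adj.ne hm
    have n1 : s(a, b) ≠ s(x, y) := fun heq => hmS (heq ▸ hxyS')
    have n2 : s(a, b) ≠ s(u, w) := fun heq => hmS (heq ▸ huwS')
    have n3 : s(a, b) ≠ s(x, u) := fun heq => hmS (heq ▸ hxuS')
    have k1 := key a b rfl
    have k2 := key b a Sym2.eq_swap
    have ha := hvert a (by simp)
    have hb := hvert b (by simp)
    simp only [ne_eq, Sym2.eq_iff] at n1 n2 n3
    grind

lemma edgeConflict_triangle {G : SimpleGraph V} {o : Sym2 V → ℕ} {x y u w : V}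
    (hxy : G.Adj x y) (hxu : G.Adj x u) (hyu : G.Adj y u) (huw : G.Adj u w)
    (hxw : x ≠ w) (hyw : y ≠ w)
    (h : o s(x, y) < o s(x, u)) (h' : o s(x, y) < o s(y, u))
    (h3 : G.Adj x w → o s(u, w) < o s(x, w) ∨ o s(x, u) < o s(x, w))
    (h4 : G.Adj y w → o s(u, w) < o s(y, w) ∨ o s(y, u) < o s(y, w)) :
    EdgeConflict G o := by
  have hxy' := hxy.ne
  have hxu' := hxu.ne
  have hyu' := hyu.ne
  have huw' := huw.ne
  refine ⟨{s(x, y), s(u, w)}, s(x, u), s(y, u), ?_, hxu, hyu, ?_, ?_, ?_, ?_, ?_⟩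
  · simp [hxy, huw]
  · simp; grind
  · simp; grind
  · simp; grind
  · refine edgePot_path hxu hxy' huw' hyu' hxw hyw h (fun _ => h') ?_ h3
    exact fun hyw => (h4 hyw).symm.imp_left h'.trans
  · rw [Sym2.eq_swap (a := x) (b := y)] at *
    refine edgePot_path hyu hxy'.symm huw' hxu' hyw hxw h' (fun _ => h) ?_ h4
    exact fun hxw => (h3 hxw).symm.imp_left h.trans

lemma edgeConflict_cycle {G : SimpleGraph V} {o : Sym2 V → ℕ} {x y u w : V}
    (hxy : G.Adj x y) (hxu : G.Adj x u) (hyw : G.Adj y w) (huw : G.Adj u w)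
    (hxw : x ≠ w) (hyu : y ≠ u)
    (h : o s(x, y) < o s(x, u)) (h' : o s(x, y) < o s(y, w))
    (h1 : G.Adj y u → o s(x, y) < o s(y, u)) (h2 : G.Adj x w → o s(x, y) < o s(x, w))
    (h3 : G.Adj x w → o s(u, w) < o s(x, w) ∨ o s(x, u) < o s(x, w))
    (h4 : G.Adj y u → o s(u, w) < o s(y, u) ∨ o s(y, w) < o s(y, u)) :
    EdgeConflict G o := by
  have hxy' := hxy.ne
  have hxu' := hxu.ne
  have hyw' := hyw.ne
  have huw' := huw.ne
  refine ⟨{s(x, y), s(u, w)}, s(x, u), s(y, w), ?_, hxu, hyw, ?_, ?_, ?_, ?_, ?_⟩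
  · simp [hxy, huw]
  · simp; grind
  · simp; grind
  · simp; grind
  · exact edgePot_path hxu hxy' huw' hyu hxw hyw' h h1 (fun _ => Or.inl h') h3
  · rw [Sym2.eq_swap (a := x) (b := y), Sym2.eq_swap (a := u) (b := w)] at *
    exact edgePot_path hyw hxy'.symm huw'.symm hxw hyu hxu' h' h2 (fun _ => Or.inl h) h4

section NoConflict

variable {G : SimpleGraph V} {o : Sym2 V → ℕ}

lemma not_lt_of_paw (hG : ¬ EdgeConflict G o) {x y u w : V} (hxy : G.Adj x y) (hxu : G.Adj x u)
    (hyu : G.Adj y u) (huw : G.Adj u w) (hxw' : x ≠ w) (hyw' : y ≠ w) (hxw : ¬ G.Adj x w)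
    (hyw : ¬ G.Adj y w) (h : o s(x, y) < o s(x, u)) : ¬ o s(x, y) < o s(y, u) := fun h' =>
  hG (edgeConflict_triangle hxy hxu hyu huw hxw' hyw' h h'
    (absurd · hxw) (absurd · hyw))

lemma lt_or_gt_of_adj (hinj : Set.InjOn o G.edgeSet)
    {a b c d : V} (h1 : G.Adj a b) (h2 : G.Adj c d)
    (hne : s(a, b) ≠ s(c, d)) : o s(a, b) < o s(c, d) ∨ o s(c, d) < o s(a, b) :=
  lt_or_gt_of_ne fun h => hne (hinj h1 h2 h)

/-- If the smallest edge of one triangle of a diamond is not the common edge, then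
the smallest edge of the other triangle meets it. -/
lemma lt_and_lt_of_diamond (hinj : Set.InjOn o G.edgeSet)
    (hG : ¬ EdgeConflict G o) {x y u w : V} (hxy : G.Adj x y)
    (hxu : G.Adj x u) (hyu : G.Adj y u) (hxw : G.Adj x w) (huw : G.Adj u w) (hyw' : y ≠ w)
    (hyw : ¬ G.Adj y w) (h : o s(x, y) < o s(x, u)) (h' : o s(x, y) < o s(y, u)) :
    o s(x, w) < o s(x, u) ∧ o s(x, w) < o s(u, w) := by
  by_contra hcon
  refine hG (edgeConflict_triangle hxy hxu hyu huw hxw.ne hyw' h h' (fun _ => ?_)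
    (absurd · hyw))
  by_contra! hle
  refine hcon ⟨lt_of_le_of_ne hle.2 fun heq => ?_, lt_of_le_of_ne hle.1 fun heq => ?_⟩
  · exact huw.ne (Sym2.congr_right.1 (hinj hxw hxu heq)).symm
  · have := hinj hxw huw heq
    rw [Sym2.eq_swap (a := x), Sym2.eq_swap (a := u)] at this
    exact hxu.ne (Sym2.congr_right.1 this)

lemma not_lt_of_diamond_aux (hinj : Set.InjOn o G.edgeSet)
    (hG : ¬ EdgeConflict G o) {x y u w : V} (hxy : G.Adj x y)
    (hxu : G.Adj x u) (hyu : G.Adj y u) (hxw : G.Adj x w) (huw : G.Adj u w) (hyw' : y ≠ w)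
    (hyw : ¬ G.Adj y w) (h : o s(x, y) < o s(x, u)) : ¬ o s(x, y) < o s(y, u) := by
  intro h'
  obtain ⟨h2, h2'⟩ := lt_and_lt_of_diamond hinj hG hxy hxu hyu hxw huw hyw' hyw h h'
  rw [Sym2.eq_swap (a := u) (b := w)] at h2'
  rcases lt_or_gt_of_adj hinj hxy hxw fun heq => hyw' (Sym2.congr_right.1 heq) with h3 | h3
  · exact hG (edgeConflict_cycle (x := x) (y := y) (u := w) (w := u) hxy hxw hyu huw.symm hxu.ne
      hyw' h3 h' (absurd · hyw) (fun _ => h) (fun _ => Or.inr h2) (absurd · hyw))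
  · rw [Sym2.eq_swap (a := y) (b := u)] at h'
    exact hG (edgeConflict_cycle (x := x) (y := w) (u := y) (w := u) hxw hxy huw.symm hyu hxu.ne
      hyw'.symm h3 h2' (fun h => (hyw h.symm).elim) (fun _ => h2) (fun _ => Or.inr h)
      (fun h => (hyw h.symm).elim))

/-- In a diamond, the common edge of the two triangles is the smallest. -/
lemma lt_of_diamond (hinj : Set.InjOn o G.edgeSet)
    (hG : ¬ EdgeConflict G o) {x y u w : V} (hxy : G.Adj x y)
    (hxu : G.Adj x u) (hyu : G.Adj y u) (hxw : G.Adj x w) (huw : G.Adj u w) (hyw' : y ≠ w)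
    (hyw : ¬ G.Adj y w) : o s(x, u) < o s(x, y) ∧ o s(x, u) < o s(y, u) := by
  have h1 := not_lt_of_diamond_aux hinj hG hxy hxu hyu hxw huw hyw' hyw
  have h2 := not_lt_of_diamond_aux hinj hG hyu.symm hxu.symm hxy.symm huw hxw hyw' hyw
  have h3 := lt_or_gt_of_adj hinj hxy hxu fun heq => hyu.ne (Sym2.congr_right.1 heq)
  have h4 := lt_or_gt_of_adj hinj hyu.symm hxu.symm fun heq => hxy.ne (Sym2.congr_right.1 heq).symm
  rw [Sym2.eq_swap (a := u) (b := y), Sym2.eq_swap (a := u) (b := x)] at *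
  rw [Sym2.eq_swap (a := y) (b := x)] at *
  have h5 := lt_or_gt_of_adj hinj hxy hyu fun heq => by
    rw [Sym2.eq_swap (a := x)] at heq
    exact hxu.ne (Sym2.congr_right.1 heq)
  omega

lemma false_of_four_clique_aux (hinj : Set.InjOn o G.edgeSet)
    (hG : ¬ EdgeConflict G o) {x y u w : V} (hxy : G.Adj x y)
    (hxu : G.Adj x u) (hxw : G.Adj x w) (hyu : G.Adj y u) (hyw : G.Adj y w) (huw : G.Adj u w)
    (h1 : o s(x, y) < o s(x, u)) (h2 : o s(x, y) < o s(x, w)) (h3 : o s(x, y) < o s(y, u))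
    (h4 : o s(x, y) < o s(y, w)) : False := by
  rcases lt_or_gt_of_adj hinj hxu hxw fun heq => huw.ne (Sym2.congr_right.1 heq) with h5 | h5 <;>
  rcases lt_or_gt_of_adj hinj hyu hyw fun heq => huw.ne (Sym2.congr_right.1 heq) with h6 | h6
  · exact hG (edgeConflict_triangle hxy hxu hyu huw hxw.ne hyw.ne h1 h3 (fun _ => Or.inr h5)
      (fun _ => Or.inr h6))
  · exact hG (edgeConflict_cycle hxy hxu hyw huw hxw.ne hyu.ne h1 h4 (fun _ => h3) (fun _ => h2)
      (fun _ => Or.inr h5) (fun _ => Or.inr h6))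
  · exact hG (edgeConflict_cycle hxy hxw hyu huw.symm hxu.ne hyw.ne h2 h3 (fun _ => h4)
      (fun _ => h1) (fun _ => Or.inr h5) (fun _ => Or.inr h6))
  · exact hG (edgeConflict_triangle hxy hxw hyw huw.symm hxu.ne hyu.ne h2 h4 (fun _ => Or.inr h5)
      (fun _ => Or.inr h6))

lemma false_of_four_clique (hinj : Set.InjOn o G.edgeSet)
    (hG : ¬ EdgeConflict G o) {x y u w : V} (hxy : G.Adj x y)
    (hxu : G.Adj x u) (hxw : G.Adj x w) (hyu : G.Adj y u) (hyw : G.Adj y w) (huw : G.Adj u w) :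
    False := by
  let f : Fin 4 → V := ![x, y, u, w]
  have hf : ∀ i j, i ≠ j → G.Adj (f i) (f j) := by
    intro i j hij
    fin_cases i <;> fin_cases j <;>
      first
        | exact (hij rfl).elim
        | assumption
        | (apply SimpleGraph.Adj.symm; assumption)
  obtain ⟨⟨i, j⟩, hij, hmin⟩ := Finset.exists_min_image
    (Finset.univ.filter fun p : Fin 4 × Fin 4 => p.1 ≠ p.2) (fun p => o s(f p.1, f p.2))
    ⟨(0, 1), by simp⟩
  simp only [Finset.mem_filter, Finset.mem_univ, true_and, Prod.forall] at hij hmin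
  have hcompl : ∀ i j : Fin 4, i ≠ j → ∃ k l, i ≠ k ∧ i ≠ l ∧ j ≠ k ∧ j ≠ l ∧ k ≠ l := by decide
  obtain ⟨k, l, hik, hil, hjk, hjl, hkl⟩ := hcompl i j hij
  have hlt : ∀ a b c, G.Adj a b → G.Adj a c → b ≠ c → o s(a, b) ≤ o s(a, c) →
      o s(a, b) < o s(a, c) := fun a b c hab hac hbc hle =>
    lt_of_le_of_ne hle fun heq => hbc (Sym2.congr_right.1 (hinj hab hac heq))
  refine false_of_four_clique_aux hinj hG (hf i j hij) (hf i k hik) (hf i l hil) (hf j k hjk)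
    (hf j l hjl) (hf k l hkl) (hlt _ _ _ (hf i j hij) (hf i k hik) (hf j k hjk).ne (hmin i k hik))
    (hlt _ _ _ (hf i j hij) (hf i l hil) (hf j l hjl).ne (hmin i l hil)) ?_ ?_
  · rw [Sym2.eq_swap (a := f i)]
    refine hlt _ _ _ (hf j i hij.symm) (hf j k hjk) (hf i k hik).ne ?_
    rw [Sym2.eq_swap (a := f j) (b := f i)]
    exact hmin j k hjk
  · rw [Sym2.eq_swap (a := f i)]
    refine hlt _ _ _ (hf j i hij.symm) (hf j l hjl) (hf i l hil).ne ?_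
    rw [Sym2.eq_swap (a := f j) (b := f i)]
    exact hmin j l hjl

lemma false_of_common_neighbor (hinj : Set.InjOn o G.edgeSet)
    (hG : ¬ EdgeConflict G o) {a b c d c' : V} (hab : G.Adj a b)
    (hac : G.Adj a c) (hbc : G.Adj b c) (had : G.Adj a d) (hbd : G.Adj b d) (hcd : c ≠ d)
    (hcc' : G.Adj c c') (ha : c' ≠ a) (hb : c' ≠ b) : False := by
  have hcd' : ¬ G.Adj c d := fun h => false_of_four_clique hinj hG hab hac had hbc hbd h
  have h1 := lt_of_diamond hinj hG hac hab hbc.symm had hbd hcd hcd'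
  by_cases hac' : G.Adj a c' <;> by_cases hbc' : G.Adj b c'
  · exact false_of_four_clique hinj hG hab hac hac' hbc hbc' hcc'
  · have := lt_of_diamond hinj hG hab hac hbc hac' hcc' hb.symm hbc'
    omega
  · have := lt_of_diamond hinj hG hab.symm hbc hac hbc' hcc' ha.symm hac'
    rw [Sym2.eq_swap (a := b) (b := a), Sym2.eq_swap (a := b) (b := c)] at this
    omega
  · refine not_lt_of_paw hG hab hac hbc hcc' ha.symm hb.symm hac' hbc' h1.1 ?_
    rw [Sym2.eq_swap (a := b)]
    exact h1.2

lemma not_lt_of_triangle (hinj : Set.InjOn o G.edgeSet)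
    (hG : ¬ EdgeConflict G o) {x y u x' y' u' : V} (hxy : G.Adj x y)
    (hxu : G.Adj x u) (hyu : G.Adj y u) (hx' : G.Adj x x') (hy' : G.Adj y y') (hu' : G.Adj u u')
    (hx'y : x' ≠ y) (hx'u : x' ≠ u) (hy'x : y' ≠ x) (hy'u : y' ≠ u) (hu'x : u' ≠ x)
    (hu'y : u' ≠ y) (h : o s(x, y) < o s(x, u)) : ¬ o s(x, y) < o s(y, u) := by
  refine not_lt_of_paw hG hxy hxu hyu hu' hu'x.symm hu'y.symm (fun hxu' => ?_) (fun hyu' => ?_) h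
  · exact false_of_common_neighbor hinj hG hxu hxy hyu.symm hxu' hu' hu'y.symm hy' hy'x hy'u
  · exact false_of_common_neighbor hinj hG hyu hxy.symm hxu.symm hyu' hu' hu'x.symm hx' hx'y hx'u

/-- Every triangle has a vertex without further neighbors. -/
lemma exists_degree_two_of_triangle (hinj : Set.InjOn o G.edgeSet)
    (hG : ¬ EdgeConflict G o) {x y u : V} (hxy : G.Adj x y)
    (hxu : G.Adj x u) (hyu : G.Adj y u) :
    (∀ v, G.Adj x v → v = y ∨ v = u) ∨ (∀ v, G.Adj y v → v = x ∨ v = u) ∨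
      (∀ v, G.Adj u v → v = x ∨ v = y) := by
  by_contra! hcon
  obtain ⟨⟨x', hx', hx'y, hx'u⟩, ⟨y', hy', hy'x, hy'u⟩, ⟨u', hu', hu'x, hu'y⟩⟩ := hcon
  have h1 := not_lt_of_triangle hinj hG hxy hxu hyu hx' hy' hu' hx'y hx'u hy'x hy'u hu'x hu'y
  have h2 := not_lt_of_triangle hinj hG hxu hxy hyu.symm hx' hu' hy' hx'u hx'y hu'x hu'y hy'x hy'u
  have h3 := not_lt_of_triangle hinj hG hyu hxy.symm hxu.symm hy' hu' hx' hy'u hy'x hu'y hu'x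
    hx'y hx'u
  have h4 := lt_or_gt_of_adj hinj hxy hxu fun heq => hyu.ne (Sym2.congr_right.1 heq)
  have h5 := lt_or_gt_of_adj hinj hxu.symm hyu.symm fun heq => hxy.ne (Sym2.congr_right.1 heq)
  have h6 := lt_or_gt_of_adj hinj hxy.symm hyu fun heq => hxu.ne (Sym2.congr_right.1 heq)
  rw [Sym2.eq_swap (a := u) (b := y), Sym2.eq_swap (a := u) (b := x)] at *
  rw [Sym2.eq_swap (a := y) (b := x)] at *
  omega

end NoConflict


/-! ### Chordal graphs whose triangles all have a vertex of degree two -/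

section DegreeTwo

lemma cycleGraph_adj_iff_of_lt {n : ℕ} {i j : Fin n} (hij : i < j) :
    (SimpleGraph.cycleGraph n).Adj i j ↔
      (j : ℕ) = i + 1 ∨ ((i : ℕ) = 0 ∧ (j : ℕ) + 1 = n) := by
  have hi := i.2
  have hj := j.2
  have hij' : (i : ℕ) < j := hij
  rw [SimpleGraph.cycleGraph_adj', Fin.sub_val_of_le hij.le, Fin.coe_sub_iff_lt.mpr hij]
  omega

/-- A graph homomorphism out of a cycle may be checked on increasing pairs of vertices. -/
lemma cycleGraph_hom_of_lt {W : Type*} {T : SimpleGraph W} {n : ℕ} {f : Fin n → W}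
    (h : ∀ i j : Fin n, i < j → (SimpleGraph.cycleGraph n).Adj i j → T.Adj (f i) (f j))
    {i j : Fin n} (hij : (SimpleGraph.cycleGraph n).Adj i j) : T.Adj (f i) (f j) := by
  rcases lt_trichotomy i j with hlt | rfl | hlt
  · exact h i j hlt hij
  · exact (hij.ne rfl).elim
  · exact (h j i hlt hij.symm).symm

lemma isAcyclic_of_chordal {W : Type*} {T : SimpleGraph W} (hT : Chordal T)
    (h3 : ∀ a b c, T.Adj a b → T.Adj a c → ¬ T.Adj b c) : T.IsAcyclic := by
  rw [SimpleGraph.isAcyclic_iff_free_cycleGraph]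
  intro n
  induction n using Nat.strong_induction_on with
  | _ n ih =>
    rintro hn ⟨f⟩
    have hf : ∀ {i j}, (SimpleGraph.cycleGraph n).Adj i j → T.Adj (f i) (f j) :=
      fun h => f.toHom.map_adj h
    rcases hn.eq_or_lt with rfl | hn4
    · refine h3 (f 0) (f 1) (f 2) (hf ?_) (hf ?_) (hf ?_) <;>
        simp [SimpleGraph.cycleGraph_three_eq_top]
    have hchord : ∀ i j : Fin n, i < j → T.Adj (f i) (f j) →
        (SimpleGraph.cycleGraph n).Adj i j := by
      intro i j hij hadj
      rw [cycleGraph_adj_iff_of_lt hij]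
      by_contra hcon
      have hij' : (i : ℕ) < j := hij
      have hj := j.2
      let g : Fin (j - i + 1) → Fin n := fun k => ⟨i + k, by omega⟩
      have hg : Function.Injective g := fun k l hkl => by
        have := congrArg Fin.val hkl
        simp only [g] at this
        exact Fin.ext (by omega)
      refine ih (j - i + 1) (by omega) (by omega) ⟨⟨⟨f ∘ g, ?_⟩, f.injective.comp hg⟩⟩
      apply cycleGraph_hom_of_lt
      intro k l hkl hadj'
      have hl := l.2
      rcases (cycleGraph_adj_iff_of_lt hkl).mp hadj' with h | ⟨hk, hl'⟩
      · refine hf ((cycleGraph_adj_iff_of_lt ?_).mpr (Or.inl ?_))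
        · simp only [g, Fin.lt_def]; omega
        · simp only [g]; omega
      · have hgk : g k = i := Fin.ext (by simp only [g]; omega)
        have hgl : g l = j := Fin.ext (by simp only [g]; omega)
        simpa only [Function.comp_apply, hgk, hgl] using hadj
    refine (hT n hn4).false ⟨⟨f, f.injective⟩, ?_⟩
    intro i j
    refine ⟨fun h => ?_, hf⟩
    change T.Adj (f i) (f j) at h
    rcases lt_trichotomy i j with hlt | rfl | hlt
    · exact hchord i j hlt h
    · exact (h.ne rfl).elim
    · exact (hchord j i hlt h.symm).symm

lemma Chordal.induce {G : SimpleGraph V} (hG : Chordal G) (s : Set V) :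
    Chordal (G.induce s) := fun n hn =>
  ⟨fun f => (hG n hn).false (f.trans (SimpleGraph.Embedding.induce s))⟩

/-- An independent set `D` of vertices, each of which spans a triangle with its two
neighbours. -/
structure TipSet (G : SimpleGraph V) (D : Set V) (a b : V → V) : Prop where
  indep : ∀ d ∈ D, ∀ e ∈ D, ¬ G.Adj d e
  adj_iff : ∀ d ∈ D, ∀ v, G.Adj d v ↔ v = a d ∨ v = b d
  adj : ∀ d ∈ D, G.Adj (a d) (b d)

namespace TipSet

variable {G : SimpleGraph V} {D : Set V} {a b : V → V}

lemma left_notMem (h : TipSet G D a b) {d : V} (hd : d ∈ D) : a d ∉ D :=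
  fun had => h.indep d hd _ had ((h.adj_iff d hd _).mpr (Or.inl rfl))

lemma right_notMem (h : TipSet G D a b) {d : V} (hd : d ∈ D) : b d ∉ D :=
  fun hbd => h.indep d hd _ hbd ((h.adj_iff d hd _).mpr (Or.inr rfl))

lemma induce_compl_connected (h : TipSet G D a b) (hG : G.Connected) :
    (G.induce Dᶜ).Connected := by
  let r : V → (Dᶜ : Set V) := fun v =>
    if hv : v ∈ D then ⟨a v, h.left_notMem hv⟩ else ⟨v, hv⟩
  have hr : ∀ v (hv : v ∈ Dᶜ), r v = ⟨v, hv⟩ := fun v hv => dif_neg hv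
  have hrD : ∀ v (hv : v ∈ D), r v = ⟨a v, h.left_notMem hv⟩ := fun v hv => dif_pos hv
  have key : ∀ u v, u ∈ D → G.Adj u v → (G.induce Dᶜ).Reachable (r u) (r v) := by
    intro u v hu huv
    have hv : v ∉ D := fun hv => h.indep u hu v hv huv
    rw [hrD u hu, hr v hv]
    rcases (h.adj_iff u hu v).mp huv with rfl | rfl
    · rfl
    · exact SimpleGraph.Adj.reachable (h.adj u hu)
  have step : ∀ u v, G.Adj u v → (G.induce Dᶜ).Reachable (r u) (r v) := by
    intro u v huv
    by_cases hu : u ∈ D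
    · exact key u v hu huv
    by_cases hv : v ∈ D
    · exact (key v u hv huv.symm).symm
    rw [hr u hu, hr v hv]
    exact SimpleGraph.Adj.reachable huv
  have walk : ∀ u v, G.Walk u v → (G.induce Dᶜ).Reachable (r u) (r v) := by
    intro u v p
    induction p with
    | nil => rfl
    | cons hadj _ ih => exact (step _ _ hadj).trans ih
  have : Nonempty (Dᶜ : Set V) := hG.nonempty.map r
  refine ⟨fun x y => ?_⟩
  obtain ⟨p⟩ := hG.preconnected x.1 y.1
  have := walk _ _ p
  rwa [hr x.1 x.2, hr y.1 y.2] at this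

end TipSet

lemma TipSet.exists_iso {V : Type} [Finite V] {G : SimpleGraph V} {D : Set V} {a b : V → V}
    (h : TipSet G D a b) :
    ∃ w : (G.induce Dᶜ).edgeSet → ℕ, Nonempty (G ≃g BFGraph (G.induce Dᶜ) w) := by
  have := Fintype.ofFinite V
  let f : D → (G.induce Dᶜ).edgeSet := fun d =>
    ⟨s(⟨a d, h.left_notMem d.2⟩, ⟨b d, h.right_notMem d.2⟩), h.adj d d.2⟩
  let w : (G.induce Dᶜ).edgeSet → ℕ := fun e => Fintype.card {d : D // f d = e}
  let ψ : D ≃ Σ e, Fin (w e) :=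
    (Equiv.sigmaFiberEquiv f).symm.trans (Equiv.sigmaCongrRight fun e => Fintype.equivFin _)
  have hψ : ∀ d, (ψ d).1 = f d := fun d => rfl
  let φ : (Dᶜ : Set V) ⊕ D ≃ V := (Equiv.sumComm _ _).trans (Equiv.Set.sumCompl D)
  let Φ : (Dᶜ : Set V) ⊕ D ≃ (Dᶜ : Set V) ⊕ Σ e, Fin (w e) :=
    Equiv.sumCongr (Equiv.refl _) ψ
  have hcross : ∀ (d : D) (x : (Dᶜ : Set V)),
      (BFGraph (G.induce Dᶜ) w).Adj (Sum.inr (ψ d)) (Sum.inl x) ↔ G.Adj d x := by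
    intro d x
    rw [bfGraph_adj_inr_inl, hψ, h.adj_iff d d.2]
    simp only [f, Sym2.mem_iff, Subtype.ext_iff]
  have hadj : ∀ x y : (Dᶜ : Set V) ⊕ D,
      (BFGraph (G.induce Dᶜ) w).Adj (Φ x) (Φ y) ↔ G.Adj (φ x) (φ y) := by
    rintro (x | d) (y | e)
    · exact bfGraph_adj_inl_inl x y
    · rw [SimpleGraph.adj_comm, G.adj_comm]
      exact hcross e x
    · exact hcross d y
    · exact iff_of_false (not_bfGraph_adj_inr_inr _ _) (h.indep d d.2 e e.2)
  exact ⟨w, ⟨⟨φ.symm.trans Φ, fun {u v} => by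
    simpa using hadj (φ.symm u) (φ.symm v)⟩⟩⟩

/-- A maximal independent set of degree-two triangle vertices meets every triangle, provided
every triangle has a vertex of degree two. -/
lemma exists_tipSet [Finite V] {G : SimpleGraph V}
    (hG : ∀ x y u, G.Adj x y → G.Adj x u → G.Adj y u →
      (∀ v, G.Adj x v → v = y ∨ v = u) ∨ (∀ v, G.Adj y v → v = x ∨ v = u) ∨
        (∀ v, G.Adj u v → v = x ∨ v = y)) :
    ∃ D a b, TipSet G D a b ∧
      ∀ x y u, G.Adj x y → G.Adj x u → G.Adj y u → x ∈ D ∨ y ∈ D ∨ u ∈ D := by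
  let S : Set V := {d | ∃ p : V × V,
    (∀ v, G.Adj d v ↔ v = p.1 ∨ v = p.2) ∧ G.Adj p.1 p.2}
  have hmemS : ∀ x y u, G.Adj x y → G.Adj x u → G.Adj y u →
      (∀ v, G.Adj x v → v = y ∨ v = u) → x ∈ S := fun x y u hxy hxu hyu h =>
    ⟨(y, u), fun v => ⟨h v, by rintro (rfl | rfl) <;> assumption⟩, hyu⟩
  obtain ⟨D, hD⟩ := (Set.toFinite
    {D : Set V | D ⊆ S ∧ ∀ d ∈ D, ∀ e ∈ D, ¬ G.Adj d e}).exists_maximal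
      ⟨∅, Set.empty_subset _, fun _ h => h.elim⟩
  have hmax : ∀ s ∈ S, s ∉ D → ∃ d ∈ D, G.Adj s d := by
    intro s hs hsD
    by_contra! hcon
    refine hsD (hD.2 ⟨Set.insert_subset hs hD.1.1, ?_⟩ (Set.subset_insert s D)
      (Set.mem_insert s D))
    rintro d (rfl | hd) e (rfl | he)
    · exact G.irrefl
    · exact hcon e he
    · exact fun hds => hcon d hd hds.symm
    · exact hD.1.2 d hd e he
  have hmeet : ∀ x y u, G.Adj x y → G.Adj x u → G.Adj y u →
      (∀ v, G.Adj x v → v = y ∨ v = u) → x ∈ D ∨ y ∈ D ∨ u ∈ D := by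
    intro x y u hxy hxu hyu h
    by_cases hx : x ∈ D
    · exact Or.inl hx
    obtain ⟨d, hd, hxd⟩ := hmax x (hmemS x y u hxy hxu hyu h) hx
    rcases h d hxd with rfl | rfl
    exacts [Or.inr (Or.inl hd), Or.inr (Or.inr hd)]
  choose! p hp using fun d (hd : d ∈ D) => hD.1.1 hd
  refine ⟨D, fun d => (p d).1, fun d => (p d).2,
    ⟨hD.1.2, fun d hd => (hp d hd).1, fun d hd => (hp d hd).2⟩, fun x y u hxy hxu hyu => ?_⟩
  rcases hG x y u hxy hxu hyu with h | h | h
  · exact hmeet x y u hxy hxu hyu h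
  · have := hmeet y x u hxy.symm hyu hxu h
    tauto
  · have := hmeet u x y hxu.symm hyu.symm hxy h
    tauto

end DegreeTwo

/-- **Theorem 4.11.** For a finite connected chordal simple graph `G` with at least one
edge, `I(G)` is bridge-friendly iff `G ≅ BF(T,w)` for some finite tree `T` and
edge-weight function `w : E(T) → ℕ`. -/
theorem edgeIdeal_bridgeFriendly_iff_chordal {V : Type} [Fintype V] (G : SimpleGraph V)
    (hconn : G.Connected) (hchordal : Chordal G) (hedge : G.edgeSet.Nonempty) :
    BridgeFriendly (edgeGens G) ↔
      (∃ (VT : Type) (_ : Fintype VT) (T : SimpleGraph VT) (_ : T.IsTree)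
        (w : T.edgeSet → ℕ), Nonempty (G ≃g BFGraph T w)) := by
  constructor
  · rintro ⟨ord, hinj, h⟩
    have hinj' : Set.InjOn (ord ∘ edgeMon) G.edgeSet := fun e he e' he' heq =>
      edgeMon_injective (hinj ((mem_edgeGens G _).mpr ⟨e, he, rfl⟩)
        ((mem_edgeGens G _).mpr ⟨e', he', rfl⟩) heq)
    obtain ⟨D, a, b, hD, hmeet⟩ := exists_tipSet fun x y u hxy hxu hyu =>
      exists_degree_two_of_triangle hinj' (not_edgeConflict_of_bridgeFriendlyWrt h) hxy hxu hyu
    have hacyc : (G.induce Dᶜ).IsAcyclic :=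
      isAcyclic_of_chordal (hchordal.induce _) fun x y u hxy hxu hyu => by
        rcases hmeet x y u hxy hxu hyu with h | h | h
        exacts [x.2 h, y.2 h, u.2 h]
    obtain ⟨w, hw⟩ := hD.exists_iso
    exact ⟨(Dᶜ : Set V), inferInstance, G.induce Dᶜ,
      ⟨hD.induce_compl_connected hconn, hacyc⟩, w, hw⟩
  · rintro ⟨VT, _, T, hT, w, ⟨φ⟩⟩
    obtain ⟨D, o, hinj, h⟩ := exists_tipOrder hT φ
    exact h.bridgeFriendly hinj.injOn hedge

end ChauHaMaithani
end
end
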